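/- arXiv:1809.04864 — 2 statements merged into one kernel-verified Lean document; each statement's English description precedes it below -/
import Mathlib

section
/- Let f ∈ B_6. Then nl_2(f) = 15 if and only if f is affine equivalent modulo RM(2,6) to one of the seven functions fun_6, fun_7, fun_8, fun_9, fun_10, fun_11, fun_12; that is, there exists g ∈ B_6 with deg(g) ≤ 2 such that f+g is affine equivalent to one of these functions. -/
open scoped BigOperators

/-- Boolean functions in `n` variables. -/
abbrev BF (n : ℕ) := (Fin n → ZMod 2) → ZMod 2

/-- Hamming distance between two Boolean functions. -/
def hd {n : ℕ} (f g : BF n) : ℕ :=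
  (Finset.univ.filter (fun x : Fin n → ZMod 2 => f x ≠ g x)).card

/-- The Reed--Muller code `RM(r,n)`: Boolean functions given by evaluation of a
multivariate polynomial over `F_2` of total degree at most `r`. -/
def RM (r n : ℕ) : Set (BF n) :=
  {f | ∃ p : MvPolynomial (Fin n) (ZMod 2),
    p.totalDegree ≤ r ∧ ∀ x, f x = MvPolynomial.eval x p}

/-- The `r`-th order nonlinearity of a Boolean function. -/
noncomputable def nl (r : ℕ) {n : ℕ} (f : BF n) : ℕ :=
  sInf {d | ∃ g ∈ RM r n, d = hd f g}

/-- Concatenation `f1 || f2` of two Boolean functions. -/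
def concat {n : ℕ} (f1 f2 : BF n) : BF (n + 1) :=
  fun x => (1 + x (Fin.last n)) * f1 (x ∘ Fin.castSucc)
    + x (Fin.last n) * f2 (x ∘ Fin.castSucc)

/-- A Boolean function is homogeneous quadratic if it is of the form
`∑_{i<j} a_{ij} x_i x_j`. -/
def HomQuad {n : ℕ} (g : BF n) : Prop :=
  ∃ a : Fin n → Fin n → ZMod 2,
    ∀ x, g x = ∑ i : Fin n, ∑ j : Fin n, (if i < j then a i j * x i * x j else 0)

/-- `Fh f r` is the set of homogeneous quadratic functions `g` with `nl(f+g) = r`. -/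
def Fh {n : ℕ} (f : BF n) (r : ℕ) : Set (BF n) :=
  {g | HomQuad g ∧ nl 1 (f + g) = r}

/-- `NFh f r = |Fh f r|`. -/
noncomputable def NFh {n : ℕ} (f : BF n) (r : ℕ) : ℕ := (Fh f r).ncard

/-- The set of 6-variable Boolean functions with nonlinearity 16. -/
def S16 : Set (BF 6) := {f | nl 1 f = 16}

/-- `f1` and `f2` are affine equivalent modulo `RM(r,n)`. -/
def AffEquivMod (r n : ℕ) (f1 f2 : BF n) : Prop :=
  ∃ A : Matrix (Fin n) (Fin n) (ZMod 2), IsUnit A ∧ ∃ b : Fin n → ZMod 2,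
    (fun x => f1 x + f2 (A.mulVec x + b)) ∈ RM r n

def fun1 : BF 6 := fun x => x 0*x 1*x 5 + x 0*x 2*x 4 + x 1*x 2*x 3

def fun2 : BF 6 := fun x => x 0*x 1*x 2*x 3 + x 0*x 1*x 5 + x 0*x 3*x 4 + x 1*x 2*x 4

def fun3 : BF 6 := fun x => x 0*x 1*x 2*x 3 + x 0*x 2*x 4 + x 0*x 3*x 5 + x 1*x 2*x 4
  + x 1*x 2*x 5 + x 1*x 3*x 4

def fun4 : BF 6 := fun x => x 0*x 1*x 2*x 5 + x 0*x 1*x 3*x 4 + x 0*x 2*x 4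
  + x 0*x 3*x 4 + x 0*x 3*x 5 + x 1*x 2*x 3

def fun5 : BF 6 := fun x => x 0*x 1*x 2*x 3*x 4 + x 0*x 2*x 4 + x 0*x 3*x 5
  + x 1*x 2*x 4 + x 1*x 2*x 5 + x 1*x 3*x 4

def fun6 : BF 6 := fun x => x 0*x 1*x 2*x 3*x 4*x 5 + x 0*x 1*x 5 + x 0*x 2*x 4
  + x 1*x 2*x 3

def fun7 : BF 6 := fun x => x 0*x 1*x 2*x 3*x 4*x 5 + x 0*x 1*x 2*x 3 + x 0*x 1*x 5
  + x 0*x 3*x 4 + x 1*x 2*x 4 + x 3*x 4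

def fun8 : BF 6 := fun x => x 0*x 1*x 2*x 3*x 4*x 5 + x 0*x 1*x 2*x 3 + x 0*x 2*x 4
  + x 0*x 3*x 5 + x 1*x 2*x 4 + x 1*x 2*x 5 + x 1*x 3*x 4

def fun9 : BF 6 := fun x => x 0*x 1*x 2*x 3*x 4*x 5 + x 0*x 1*x 2*x 5 + x 0*x 1*x 3*x 4
  + x 0*x 2*x 4 + x 0*x 3*x 4 + x 0*x 3*x 5 + x 1*x 2*x 3 + x 3*x 5

def fun10 : BF 6 := fun x => x 0*x 1*x 2*x 3*x 4*x 5 + x 0*x 1*x 2*x 3 + x 0*x 2*x 3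
  + x 0*x 4*x 5 + x 1*x 2*x 3 + x 1*x 2*x 5 + x 1*x 3*x 4 + x 2*x 3 + x 2*x 5 + x 3*x 4

def fun11 : BF 6 := fun x => x 0*x 1*x 2*x 3*x 4*x 5 + x 0*x 1*x 2*x 5 + x 0*x 1*x 3*x 4
  + x 0*x 2*x 4 + x 0*x 3*x 4 + x 0*x 3*x 5 + x 1*x 2*x 3 + x 1*x 2*x 5 + x 1*x 3*x 4
  + x 2*x 4 + x 3*x 4 + x 3*x 5

def fun12 : BF 6 := fun x => x 0*x 1*x 2*x 3*x 4*x 5 + x 1*x 2*x 3*x 4 + x 0*x 1*x 4*x 5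
  + x 0*x 2*x 3*x 5 + x 0*x 1*x 3 + x 0*x 1*x 4 + x 1*x 2*x 4 + x 2*x 3*x 4
  + x 0*x 1*x 5 + x 2*x 3*x 5

def g0 : BF 6 := fun x => x 0*x 1*x 2 + x 0*x 3*x 4 + x 1*x 3*x 5 + x 2*x 4*x 5
  + x 3*x 4*x 5


/-! ### Sets of bit vectors stored as natural numbers -/

/-- Add bit `i` of `c` to bit `j`; for `i ≥ n` bit `j` is always flipped. -/
def ctrlFlip (n i j c : ℕ) : ℕ := if i < n → c.testBit i = true then c ^^^ 2 ^ j else c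

/-- The set of all `c < 2 ^ n` with bit `i` set (if `i < n`) and bit `j` cleared (if `j < n`). -/
def ctrlMask (i j : ℕ) : ℕ → ℕ
  | 0 => 1
  | n + 1 =>
    if n = i then ctrlMask i j n <<< 2 ^ n
    else if n = j then ctrlMask i j n
    else ctrlMask i j n ||| ctrlMask i j n <<< 2 ^ n

/-- Image of a set of `n`-bit vectors under the involution `ctrlFlip n i j`. -/
def permBits (n i j S : ℕ) : ℕ :=
  let t := (S >>> 2 ^ j ^^^ S) &&& ctrlMask i j n
  S ^^^ t ^^^ t <<< 2 ^ j

/-- Evaluate `f` at `s`, forcing the kernel to compute `s` first. -/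
def evalFirst {α : Type*} (f : ℕ → α) : ℕ → α
  | 0 => f 0
  | m + 1 => f (m + 1)

theorem evalFirst_eq {α : Type*} (f : ℕ → α) (s : ℕ) : evalFirst f s = f s := by
  cases s <;> rfl

/-- Apply `permBits` successively for all pairs in a list. -/
def permBitsList (n : ℕ) : List (ℕ × ℕ) → ℕ → ℕ
  | [], S => S
  | o :: os, S => evalFirst (permBitsList n os) (permBits n o.1 o.2 S)

/-- The map on bit vectors along which `permBitsList` pulls back. -/
def ctrlFlipList (n : ℕ) : List (ℕ × ℕ) → ℕ → ℕ
  | [], c => c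
  | o :: os, c => ctrlFlip n o.1 o.2 (ctrlFlipList n os c)

theorem ctrlMask_lt (i j n : ℕ) : ctrlMask i j n < 2 ^ 2 ^ n := by
  induction n with
  | zero => simp [ctrlMask]
  | succ n ih =>
    have h1 : ctrlMask i j n <<< 2 ^ n < 2 ^ 2 ^ (n + 1) := by
      rw [show 2 ^ (n + 1) = 2 ^ n + 2 ^ n by ring]
      exact Nat.shiftLeft_lt ih
    have h2 : ctrlMask i j n < 2 ^ 2 ^ (n + 1) :=
      ih.trans_le (Nat.pow_le_pow_right (by norm_num) (Nat.pow_le_pow_right (by norm_num) (by omega)))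
    unfold ctrlMask
    split_ifs
    · exact h1
    · exact h2
    · exact Nat.or_lt_two_pow h2 h1

theorem testBit_top {n c : ℕ} (hc : c < 2 ^ (n + 1)) : c.testBit n = decide (2 ^ n ≤ c) := by
  rw [Nat.testBit_eq_decide_div_mod_eq]
  congr 1
  have h : 2 ^ (n + 1) = 2 ^ n + 2 ^ n := by ring
  have h0 : 0 < 2 ^ n := by positivity
  by_cases hl : 2 ^ n ≤ c
  · have : c / 2 ^ n = 1 := by
      rw [Nat.div_eq_iff h0]; omega
    simp [this, hl]
  · have : c / 2 ^ n = 0 := Nat.div_eq_of_lt (by omega)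
    simp [this, hl]

theorem testBit_sub_top {n c k : ℕ} (h : 2 ^ n ≤ c) (hk : k < n) :
    (c - 2 ^ n).testBit k = c.testBit k := by
  conv_rhs => rw [← Nat.add_sub_cancel' h]
  rw [Nat.testBit_two_pow_add_gt hk]

theorem testBit_ctrlMask {i j n c : ℕ} (hij : i ≠ j) (hc : c < 2 ^ n) :
    (ctrlMask i j n).testBit c = true ↔
      (i < n → c.testBit i = true) ∧ (j < n → c.testBit j = false) := by
  induction n generalizing c with
  | zero =>
    obtain rfl : c = 0 := by simpa using hc
    simp [ctrlMask]
  | succ n ih =>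
    have h : 2 ^ (n + 1) = 2 ^ n + 2 ^ n := by ring
    have htop := testBit_top hc
    by_cases hl : 2 ^ n ≤ c
    · have hlt := ih (c := c - 2 ^ n) (by omega)
      have e : ∀ k < n, (c - 2 ^ n).testBit k = c.testBit k := fun k hk => testBit_sub_top hl hk
      have hz : (ctrlMask i j n).testBit c = false :=
        Nat.testBit_lt_two_pow ((ctrlMask_lt i j n).trans_le (Nat.pow_le_pow_right (by norm_num) hl))
      have hs : (ctrlMask i j n <<< 2 ^ n).testBit c = true ↔
          (i < n → c.testBit i = true) ∧ (j < n → c.testBit j = false) := by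
        rw [Nat.testBit_shiftLeft]
        simp only [ge_iff_le, hl, decide_true, Bool.true_and, hlt]
        constructor <;> rintro ⟨a, b⟩ <;> refine ⟨fun hi => ?_, fun hj => ?_⟩
        · rw [← e i hi]; exact a hi
        · rw [← e j hj]; exact b hj
        · rw [e i hi]; exact a hi
        · rw [e j hj]; exact b hj
      simp only [hl, decide_true] at htop
      unfold ctrlMask
      split_ifs with h1 h2
      · subst h1
        rw [hs]
        have : j < n + 1 ↔ j < n := by omega
        simp [this, htop]
      · subst h2
        simp [hz, htop]
      · rw [Nat.testBit_or, hz, Bool.false_or, hs]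
        have h3 : j < n + 1 ↔ j < n := by omega
        have h4 : i < n + 1 ↔ i < n := by omega
        rw [h3, h4]
    · have hlt := ih (c := c) (by omega)
      have hs : (ctrlMask i j n <<< 2 ^ n).testBit c = false := by
        rw [Nat.testBit_shiftLeft]; simp [hl]
      simp only [hl, decide_false] at htop
      unfold ctrlMask
      split_ifs with h1 h2
      · subst h1
        simp [hs, htop]
      · subst h2
        rw [hlt]
        have : i < n + 1 ↔ i < n := by omega
        simp [this, htop]
      · rw [Nat.testBit_or, hs, Bool.or_false, hlt]
        have h3 : j < n + 1 ↔ j < n := by omega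
        have h4 : i < n + 1 ↔ i < n := by omega
        rw [h3, h4]

theorem xor_two_pow_of_testBit_eq_false {c j : ℕ} (h : c.testBit j = false) :
    c ^^^ 2 ^ j = c + 2 ^ j := by
  have h0 : 0 < 2 ^ j := by positivity
  have hlo : c % 2 ^ j < 2 ^ j := Nat.mod_lt _ h0
  have hc := Nat.div_add_mod c (2 ^ j)
  have he : c / 2 ^ j % 2 = 0 := by
    rw [Nat.testBit_eq_decide_div_mod_eq] at h
    have := of_decide_eq_false h
    omega
  have h1 : c / 2 ^ j + 1 = c / 2 ^ j ^^^ 1 := by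
    have := Nat.even_iff.2 he
    exact (Nat.xor_one_of_even this).symm
  apply Nat.eq_of_testBit_eq
  intro k
  have hadd : c + 2 ^ j = 2 ^ j * (c / 2 ^ j + 1) + c % 2 ^ j := by
    rw [mul_add]; omega
  rw [Nat.testBit_xor, hadd, Nat.testBit_two_pow_mul_add _ hlo, Nat.testBit_two_pow]
  split_ifs with hk
  · have : j ≠ k := by omega
    simp [this, Nat.testBit_mod_two_pow, hk]
  · rw [h1, Nat.testBit_xor, Nat.testBit_div_two_pow]
    have : k - j + j = k := by omega
    rw [this, show (1 : ℕ) = 2 ^ 0 by rfl, Nat.testBit_two_pow]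
    congr 2
    simp only [eq_iff_iff]
    omega

theorem xor_two_pow_of_testBit {c j : ℕ} (h : c.testBit j = true) :
    2 ^ j ≤ c ∧ c ^^^ 2 ^ j = c - 2 ^ j := by
  have h1 : (c ^^^ 2 ^ j).testBit j = false := by
    simp [Nat.testBit_xor, h]
  have h2 := xor_two_pow_of_testBit_eq_false h1
  rw [Nat.xor_assoc, Nat.xor_self, Nat.xor_zero] at h2
  omega

theorem testBit_permBits {n i j c : ℕ} (S : ℕ) (hij : i ≠ j) (hj : j < n) (hc : c < 2 ^ n) :
    (permBits n i j S).testBit c = S.testBit (ctrlFlip n i j c) := by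
  have hM := testBit_ctrlMask hij hc
  have hi (d : ℕ) : (d ^^^ 2 ^ j).testBit i = d.testBit i := by
    simp [Nat.testBit_xor, hij.symm]
  simp only [permBits, Nat.testBit_xor, Nat.testBit_and, Nat.testBit_shiftRight,
    Nat.testBit_shiftLeft]
  by_cases hb : c.testBit j = true
  · obtain ⟨hle, hsub⟩ := xor_two_pow_of_testBit hb
    have hM' := testBit_ctrlMask (c := c - 2 ^ j) hij (lt_of_le_of_lt (Nat.sub_le _ _) hc)
    have hz : (c - 2 ^ j).testBit j = false := by
      rw [← hsub]; simp [Nat.testBit_xor, hb]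
    have hMf : (ctrlMask i j n).testBit c = false := by
      rw [← Bool.not_eq_true, hM]
      simp [hj, hb]
    rw [← hsub, hi, hsub] at hM'
    have hadd : 2 ^ j + (c - 2 ^ j) = c := by omega
    simp only [hMf, Bool.and_false, Bool.xor_false, ge_iff_le, hle, decide_true, Bool.true_and,
      hadd, ctrlFlip]
    split_ifs with hctrl
    · have : (ctrlMask i j n).testBit (c - 2 ^ j) = true := hM'.2 ⟨hctrl, fun _ => hz⟩
      rw [this, hsub]
      cases S.testBit c <;> cases S.testBit (c - 2 ^ j) <;> rfl
    · have : (ctrlMask i j n).testBit (c - 2 ^ j) = false := by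
        rw [← Bool.not_eq_true, hM']
        exact fun h => hctrl h.1
      simp [this]
  · simp only [Bool.not_eq_true] at hb
    have hadd := xor_two_pow_of_testBit_eq_false hb
    have hMf : 2 ^ j ≤ c → (ctrlMask i j n).testBit (c - 2 ^ j) = false := by
      intro hle
      have hM' := testBit_ctrlMask (c := c - 2 ^ j) hij (lt_of_le_of_lt (Nat.sub_le _ _) hc)
      rw [← Bool.not_eq_true, hM']
      rintro ⟨-, h2⟩
      have h3 := xor_two_pow_of_testBit_eq_false (h2 hj)
      rw [Nat.sub_add_cancel hle] at h3
      rw [← h3] at hb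
      simp [Nat.testBit_xor, h2 hj] at hb
    have hr : (decide (c ≥ 2 ^ j) && ((S.testBit (2 ^ j + (c - 2 ^ j)) ^^ S.testBit (c - 2 ^ j)) &&
        (ctrlMask i j n).testBit (c - 2 ^ j))) = false := by
      by_cases hle : 2 ^ j ≤ c
      · simp [hMf hle]
      · simp [hle]
    rw [hr]
    simp only [ctrlFlip]
    split_ifs with hctrl
    · have : (ctrlMask i j n).testBit c = true := hM.2 ⟨hctrl, fun _ => hb⟩
      rw [this, hadd, add_comm c]
      cases S.testBit c <;> cases S.testBit (2 ^ j + c) <;> rfl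
    · have : (ctrlMask i j n).testBit c = false := by
        rw [← Bool.not_eq_true, hM]
        exact fun h => hctrl h.1
      simp [this]

theorem ctrlFlip_lt {n i j c : ℕ} (hj : j < n) (hc : c < 2 ^ n) : ctrlFlip n i j c < 2 ^ n := by
  unfold ctrlFlip
  split_ifs
  · exact Nat.xor_lt_two_pow hc (Nat.pow_lt_pow_right (by norm_num) hj)
  · exact hc

/-- The pairs describe elementary operations on `n`-bit vectors. -/
def ValidOps (n : ℕ) (os : List (ℕ × ℕ)) : Prop := ∀ o ∈ os, o.1 ≠ o.2 ∧ o.2 < n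

theorem ctrlFlipList_lt {n c : ℕ} {os : List (ℕ × ℕ)} (h : ValidOps n os) (hc : c < 2 ^ n) :
    ctrlFlipList n os c < 2 ^ n := by
  induction os with
  | nil => exact hc
  | cons o os ih =>
    have ho := h o (by simp)
    exact ctrlFlip_lt ho.2 (ih fun p hp => h p (by simp [hp]))

theorem testBit_permBitsList {n c : ℕ} {os : List (ℕ × ℕ)} (h : ValidOps n os) (hc : c < 2 ^ n)
    (S : ℕ) : (permBitsList n os S).testBit c = S.testBit (ctrlFlipList n os c) := by
  induction os generalizing S with
  | nil => rfl
  | cons o os ih =>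
    have ho := h o (by simp)
    have hos : ValidOps n os := fun p hp => h p (by simp [hp])
    rw [permBitsList, evalFirst_eq, ih hos, testBit_permBits S ho.1 ho.2 (ctrlFlipList_lt hos hc)]
    rfl

/-! ### Truth tables -/

/-- Bit `k` of `c` as an element of `F_2`. -/
def bitF2 (c k : ℕ) : ZMod 2 := if c.testBit k = true then 1 else 0

theorem bitF2_xor (a b k : ℕ) : bitF2 (a ^^^ b) k = bitF2 a k + bitF2 b k := by
  simp only [bitF2, Nat.testBit_xor]
  cases a.testBit k <;> cases b.testBit k <;> decide

theorem bitF2_and (a b k : ℕ) : bitF2 (a &&& b) k = bitF2 a k * bitF2 b k := by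
  simp only [bitF2, Nat.testBit_and]
  cases a.testBit k <;> cases b.testBit k <;> decide

theorem zmod_two_cases (a : ZMod 2) : a = 0 ∨ a = 1 := by
  revert a; decide

theorem vec_add_self {α : Type*} (f : α → ZMod 2) : f + f = 0 := by
  funext x; exact CharTwo.add_self_eq_zero (f x)

/-- The number whose first `n` bits are the first `n` coordinates of `x`. -/
def pointIdx (x : Fin 6 → ZMod 2) : ℕ → ℕ
  | 0 => 0
  | n + 1 => pointIdx x n + if h : n < 6 then 2 ^ n * (x ⟨n, h⟩).val else 0

theorem pointIdx_lt (x : Fin 6 → ZMod 2) (n : ℕ) : pointIdx x n < 2 ^ n := by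
  induction n with
  | zero => simp [pointIdx]
  | succ n ih =>
    have : 2 ^ (n + 1) = 2 ^ n + 2 ^ n := by ring
    rw [pointIdx]
    split_ifs with h
    · rcases zmod_two_cases (x ⟨n, h⟩) with e | e <;> simp [e, ZMod.val_one] <;> omega
    · omega

theorem testBit_pointIdx (x : Fin 6 → ZMod 2) {n : ℕ} {i : Fin 6} (hi : i < n) :
    bitF2 (pointIdx x n) i = x i := by
  induction n with
  | zero => omega
  | succ n ih =>
    rw [pointIdx]
    by_cases hin : (i : ℕ) = n
    · subst hin
      have hlt := pointIdx_lt x i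
      simp only [i.isLt, dif_pos]
      rcases zmod_two_cases (x i) with e | e
      · simp [e, bitF2, Nat.testBit_lt_two_pow hlt]
      · rw [add_comm, e]
        simp [bitF2, ZMod.val_one, Nat.testBit_two_pow_add_eq, Nat.testBit_lt_two_pow hlt]
    · have hlt : (i : ℕ) < n := by omega
      rw [← ih hlt]
      split_ifs with h
      · rcases zmod_two_cases (x ⟨n, h⟩) with e | e
        · simp [e]
        · rw [add_comm, e]
          simp [bitF2, ZMod.val_one, Nat.testBit_two_pow_add_gt hlt]
      · rfl

/-- The point of `F_2^6` with coordinates the bits of `k`. -/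
def bitPoint (k : ℕ) : Fin 6 → ZMod 2 := fun i => bitF2 k i

theorem bitPoint_pointIdx (x : Fin 6 → ZMod 2) : bitPoint (pointIdx x 6) = x := by
  funext i; exact testBit_pointIdx x i.isLt

theorem bitF2_inj {a b k : ℕ} (h : bitF2 a k = bitF2 b k) : a.testBit k = b.testBit k := by
  revert h
  unfold bitF2
  cases a.testBit k <;> cases b.testBit k <;> simp

theorem eq_of_bitF2_eq {n a b : ℕ} (ha : a < 2 ^ n) (hb : b < 2 ^ n)
    (h : ∀ k < n, bitF2 a k = bitF2 b k) : a = b := by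
  apply Nat.eq_of_testBit_eq
  intro k
  by_cases hk : k < n
  · exact bitF2_inj (h k hk)
  · have h2 : 2 ^ n ≤ 2 ^ k := Nat.pow_le_pow_right (by norm_num) (by omega)
    rw [Nat.testBit_lt_two_pow (ha.trans_le h2), Nat.testBit_lt_two_pow (hb.trans_le h2)]

theorem pointIdx_bitPoint {k : ℕ} (hk : k < 64) : pointIdx (bitPoint k) 6 = k :=
  eq_of_bitF2_eq (n := 6) (pointIdx_lt _ 6) hk fun i hi =>
    testBit_pointIdx (bitPoint k) (i := ⟨i, hi⟩) hi

/-- The Boolean function with truth table `v`. -/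
def ofTable (v : ℕ) : BF 6 := fun x => bitF2 v (pointIdx x 6)

theorem ofTable_xor (a b : ℕ) : ofTable (a ^^^ b) = ofTable a + ofTable b := by
  funext x; exact bitF2_xor a b _

theorem ofTable_zero : ofTable 0 = 0 := by
  funext x; simp [ofTable, bitF2]

/-- The number of points at which the function with truth table `v` takes the value one. -/
def tableWeight (v : ℕ) : ℕ → ℕ
  | 0 => 0
  | n + 1 => tableWeight v n + (v.testBit n).toNat

theorem tableWeight_eq (v n : ℕ) :
    tableWeight v n = ((Finset.range n).filter fun k => v.testBit k = true).card := by
  induction n with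
  | zero => rfl
  | succ n ih =>
    rw [tableWeight, ih, Finset.range_add_one, Finset.filter_insert]
    split_ifs with h <;> simp [h]

theorem hd_ofTable (a b : ℕ) : hd (ofTable a) (ofTable b) = tableWeight (a ^^^ b) 64 := by
  have hne (k : ℕ) : bitF2 a k ≠ bitF2 b k ↔ (a ^^^ b).testBit k = true := by
    simp only [bitF2, Nat.testBit_xor]
    cases a.testBit k <;> cases b.testBit k <;> simp
  rw [tableWeight_eq, hd]
  refine Finset.card_bij' (fun x _ => pointIdx x 6) (fun k _ => bitPoint k) ?_ ?_ ?_ ?_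
  · intro x hx
    have h := pointIdx_lt x 6
    simp only [Finset.mem_filter, Finset.mem_univ, true_and] at hx
    simp only [Finset.mem_filter, Finset.mem_range]
    exact ⟨h, (hne _).1 hx⟩
  · intro k hk
    simp only [Finset.mem_filter, Finset.mem_range] at hk
    rw [Finset.mem_filter]
    refine ⟨Finset.mem_univ _, ?_⟩
    change bitF2 a (pointIdx (bitPoint k) 6) ≠ bitF2 b (pointIdx (bitPoint k) 6)
    rw [pointIdx_bitPoint hk.1]
    exact (hne k).2 hk.2
  · intro x _; exact bitPoint_pointIdx x
  · intro k hk
    simp only [Finset.mem_filter, Finset.mem_range] at hk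
    exact pointIdx_bitPoint hk.1

/-! ### Affine substitutions -/

/-- Invertible affine transformations of `F_2^n`. -/
def IsAffine {n : ℕ} (t : (Fin n → ZMod 2) → Fin n → ZMod 2) : Prop :=
  ∃ A : Matrix (Fin n) (Fin n) (ZMod 2), IsUnit A ∧ ∃ b, ∀ x, t x = A.mulVec x + b

theorem IsAffine.id {n : ℕ} : IsAffine (fun x : Fin n → ZMod 2 => x) :=
  ⟨1, isUnit_one, 0, by simp⟩

theorem IsAffine.comp {n : ℕ} {s t : (Fin n → ZMod 2) → Fin n → ZMod 2} (hs : IsAffine s)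
    (ht : IsAffine t) : IsAffine (s ∘ t) := by
  obtain ⟨A, hA, a, ha⟩ := hs
  obtain ⟨B, hB, b, hb⟩ := ht
  refine ⟨A * B, hA.mul hB, A.mulVec b + a, fun x => ?_⟩
  rw [Function.comp_apply, ha, hb, Matrix.mulVec_add, Matrix.mulVec_mulVec, add_assoc]

theorem IsAffine.exists_inverse {n : ℕ} {t : (Fin n → ZMod 2) → Fin n → ZMod 2}
    (ht : IsAffine t) : ∃ s, IsAffine s ∧ t ∘ s = _root_.id ∧ s ∘ t = _root_.id := by
  obtain ⟨A, hA, b, hb⟩ := ht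
  obtain ⟨B, hAB, hBA⟩ := isUnit_iff_exists.1 hA
  refine ⟨fun x => B.mulVec x + B.mulVec b, ⟨B, ⟨⟨B, A, hBA, hAB⟩, rfl⟩, _, fun _ => rfl⟩, ?_, ?_⟩
  · funext x
    simp only [Function.comp_apply, hb, Matrix.mulVec_add, Matrix.mulVec_mulVec, hAB,
      Matrix.one_mulVec, id_eq, add_assoc, vec_add_self, add_zero]
  · funext x
    simp only [Function.comp_apply, hb, Matrix.mulVec_add, Matrix.mulVec_mulVec, hBA,
      Matrix.one_mulVec, id_eq, add_assoc, vec_add_self, add_zero]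

theorem zero_mem_RM (r n : ℕ) : (0 : BF n) ∈ RM r n := ⟨0, by simp, by simp⟩

theorem add_mem_RM {r n : ℕ} {f g : BF n} (hf : f ∈ RM r n) (hg : g ∈ RM r n) :
    f + g ∈ RM r n := by
  obtain ⟨p, hp, hp'⟩ := hf
  obtain ⟨q, hq, hq'⟩ := hg
  exact ⟨p + q, (MvPolynomial.totalDegree_add p q).trans (max_le hp hq), fun x => by
    simp [hp', hq']⟩

theorem comp_mem_RM {r n : ℕ} {f : BF n} {t : (Fin n → ZMod 2) → Fin n → ZMod 2}
    (hf : f ∈ RM r n) (ht : IsAffine t) : f ∘ t ∈ RM r n := by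
  obtain ⟨p, hp, hp'⟩ := hf
  obtain ⟨A, -, b, hb⟩ := ht
  let l : Fin n → MvPolynomial (Fin n) (ZMod 2) := fun i =>
    ∑ j, MvPolynomial.C (A i j) * MvPolynomial.X j + MvPolynomial.C (b i)
  have hl (i : Fin n) : (l i).totalDegree ≤ 1 := by
    refine (MvPolynomial.totalDegree_add _ _).trans (max_le ?_ (by simp))
    refine MvPolynomial.totalDegree_finsetSum_le fun j _ => ?_
    refine (MvPolynomial.totalDegree_mul _ _).trans ?_
    simp [MvPolynomial.totalDegree_X]
  refine ⟨MvPolynomial.bind₁ l p, ?_, fun x => ?_⟩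
  · rw [MvPolynomial.bind₁, MvPolynomial.aeval_def, MvPolynomial.eval₂_eq]
    refine MvPolynomial.totalDegree_finsetSum_le fun s hs => ?_
    refine (MvPolynomial.totalDegree_mul _ _).trans ?_
    rw [MvPolynomial.algebraMap_eq, MvPolynomial.totalDegree_C, zero_add]
    refine (MvPolynomial.totalDegree_finsetProd _ _).trans ?_
    refine le_trans (Finset.sum_le_sum fun i _ => (MvPolynomial.totalDegree_pow _ _).trans
      (Nat.mul_le_mul_left (s i) (hl i))) ?_
    simp only [mul_one]
    exact (MvPolynomial.le_totalDegree hs).trans hp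
  · have h : MvPolynomial.eval x (MvPolynomial.bind₁ l p) =
        MvPolynomial.eval (fun i => MvPolynomial.eval x (l i)) p :=
      MvPolynomial.eval₂Hom_bind₁ _ _ _ _
    rw [Function.comp_apply, hp', h]
    congr 2
    funext i
    simp [l, hb, Matrix.mulVec, dotProduct]

/-- The affine map that adds coordinate `i` (or the constant one, if `i ≥ 6`) to coordinate `j`. -/
def ctrlAdd (i j : ℕ) (x : Fin 6 → ZMod 2) : Fin 6 → ZMod 2 := fun k =>
  x k + if (k : ℕ) = j then (if h : i < 6 then x ⟨i, h⟩ else 1) else 0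

theorem isAffine_ctrlAdd {i j : ℕ} (hij : i ≠ j) (hj : j < 6) : IsAffine (ctrlAdd i j) := by
  by_cases hi : i < 6
  · refine ⟨Matrix.transvection ⟨j, hj⟩ ⟨i, hi⟩ 1, ?_, 0, fun x => ?_⟩
    · rw [Matrix.isUnit_iff_isUnit_det, Matrix.det_transvection_of_ne _ _ (by simp [hij.symm])]
      exact isUnit_one
    · rw [add_zero]
      funext k
      simp only [Matrix.transvection, Matrix.add_mulVec, Matrix.one_mulVec,
        Pi.add_apply, ctrlAdd, hi, dif_pos]
      congr 1
      rw [Matrix.single_mulVec]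
      by_cases hk : (k : ℕ) = j
      · obtain rfl : k = ⟨j, hj⟩ := Fin.ext hk
        simp
      · have : k ≠ ⟨j, hj⟩ := fun h => hk (by rw [h])
        simp [hk, this]
  · refine ⟨1, isUnit_one, Pi.single ⟨j, hj⟩ 1, fun x => ?_⟩
    funext k
    simp only [Matrix.one_mulVec, Pi.add_apply, ctrlAdd, hi, dif_neg, not_false_eq_true]
    congr 1
    by_cases hk : (k : ℕ) = j
    · obtain rfl : k = ⟨j, hj⟩ := Fin.ext hk
      simp
    · have : k ≠ ⟨j, hj⟩ := fun h => hk (by rw [h])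
      simp [hk, this]

theorem bitF2_ctrlFlip (n i j c k : ℕ) : bitF2 (ctrlFlip n i j c) k =
    bitF2 c k + if k = j then (if i < n then bitF2 c i else 1) else 0 := by
  have h2 : bitF2 (2 ^ j) k = if k = j then 1 else 0 := by
    by_cases h : k = j
    · simp [bitF2, h]
    · have : j ≠ k := fun e => h e.symm
      simp [bitF2, h, this]
  unfold ctrlFlip
  by_cases hi : i < n
  · cases hb : c.testBit i
    · simp [hi, bitF2, hb]
    · simp only [forall_const, if_true, bitF2_xor, h2, hi]
      simp [bitF2, hb]
  · simp [hi, bitF2_xor, h2]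

theorem pointIdx_ctrlAdd {i j : ℕ} (hj : j < 6) (x : Fin 6 → ZMod 2) :
    pointIdx (ctrlAdd i j x) 6 = ctrlFlip 6 i j (pointIdx x 6) := by
  refine eq_of_bitF2_eq (n := 6) (pointIdx_lt _ 6) (ctrlFlip_lt hj (pointIdx_lt _ 6)) fun k hk => ?_
  rw [bitF2_ctrlFlip, testBit_pointIdx _ (i := ⟨k, hk⟩) hk, testBit_pointIdx _ (i := ⟨k, hk⟩) hk]
  by_cases hi : i < 6
  · rw [testBit_pointIdx _ (i := ⟨i, hi⟩) hi]
    simp [ctrlAdd, hi]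
  · simp [ctrlAdd, hi]

theorem ofTable_permBits {i j : ℕ} (hij : i ≠ j) (hj : j < 6) (v : ℕ) :
    ofTable (permBits 6 i j v) = ofTable v ∘ ctrlAdd i j := by
  funext x
  have h := testBit_permBits v hij hj (pointIdx_lt x 6)
  simp only [ofTable, Function.comp_apply, pointIdx_ctrlAdd hj, bitF2, h]

theorem exists_ofTable_permBitsList {os : List (ℕ × ℕ)} (h : ValidOps 6 os) :
    ∃ t, IsAffine t ∧ ∀ v, ofTable (permBitsList 6 os v) = ofTable v ∘ t := by
  induction os with
  | nil => exact ⟨_, IsAffine.id, fun v => rfl⟩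
  | cons o os ih =>
    obtain ⟨t, ht, hv⟩ := ih fun p hp => h p (by simp [hp])
    have ho := h o (by simp)
    refine ⟨_, (isAffine_ctrlAdd ho.1 ho.2).comp ht, fun v => ?_⟩
    rw [permBitsList, evalFirst_eq, hv, ofTable_permBits ho.1 ho.2, Function.comp_assoc]

/-! ### Reed–Muller codes and truth tables -/

/-- A test whether the first `2 ^ n` bits of `v` are the truth table of a polynomial of degree
less than `r`, through the decomposition `f₀ + x_n (f₀ + f₁)`. -/
def degLtTest : ℕ → ℕ → ℕ → Bool
  | 0, _, v => v == 0
  | _ + 1, 0, _ => true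
  | r + 1, n + 1, v =>
    degLtTest (r + 1) n (v % 2 ^ 2 ^ n) && degLtTest r n (v % 2 ^ 2 ^ n ^^^ v >>> 2 ^ n)

theorem exists_poly_of_degLtTest {r n v : ℕ} (hn : n ≤ 6) (h : degLtTest r n v = true) :
    ∃ p : MvPolynomial (Fin 6) (ZMod 2), (r = 0 → p = 0) ∧ p.totalDegree ≤ r - 1 ∧
      ∀ x, bitF2 v (pointIdx x n) = MvPolynomial.eval x p := by
  induction n generalizing r v with
  | zero =>
    cases r with
    | zero =>
      have : v = 0 := by simpa [degLtTest] using h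
      exact ⟨0, by simp, by simp, by simp [this, bitF2]⟩
    | succ r => exact ⟨MvPolynomial.C (bitF2 v 0), by simp, by simp, by simp [pointIdx]⟩
  | succ n ih =>
    cases r with
    | zero =>
      have : v = 0 := by simpa [degLtTest] using h
      exact ⟨0, by simp, by simp, by simp [this, bitF2]⟩
    | succ r =>
      rw [degLtTest, Bool.and_eq_true] at h
      obtain ⟨p, -, hp, hpe⟩ := ih (by omega) h.1
      obtain ⟨q, hq0, hq, hqe⟩ := ih (by omega) h.2
      have hn' : n < 6 := by omega
      refine ⟨p + MvPolynomial.X ⟨n, hn'⟩ * q, by simp, ?_, fun x => ?_⟩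
      · refine (MvPolynomial.totalDegree_add _ _).trans (max_le hp ?_)
        rcases Nat.eq_zero_or_pos r with rfl | hr
        · simp [hq0 rfl]
        · refine (MvPolynomial.totalDegree_mul _ _).trans ?_
          rw [MvPolynomial.totalDegree_X]
          omega
      · have hlt := pointIdx_lt x n
        have hlo : bitF2 (v % 2 ^ 2 ^ n) (pointIdx x n) = bitF2 v (pointIdx x n) := by
          simp [bitF2, Nat.testBit_mod_two_pow, hlt]
        have hhi : bitF2 (v >>> 2 ^ n) (pointIdx x n) = bitF2 v (2 ^ n + pointIdx x n) := by
          simp [bitF2, Nat.testBit_shiftRight]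
        rw [map_add, map_mul, MvPolynomial.eval_X, ← hpe, ← hqe, bitF2_xor, hlo, hhi, pointIdx]
        simp only [hn', dif_pos]
        rcases zmod_two_cases (x ⟨n, hn'⟩) with e | e
        · simp [e]
        · simp only [e, ZMod.val_one, mul_one, one_mul, add_comm (pointIdx x n)]
          rw [← add_assoc, CharTwo.add_self_eq_zero, zero_add]

theorem ofTable_mem_RM {r v : ℕ} (h : degLtTest (r + 1) 6 v = true) : ofTable v ∈ RM r 6 := by
  obtain ⟨p, -, hp, he⟩ := exists_poly_of_degLtTest le_rfl h
  exact ⟨p, hp, he⟩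

/-- The Reed–Muller code as an additive group. -/
def RMGroup (r n : ℕ) : AddSubgroup (BF n) where
  carrier := RM r n
  zero_mem' := zero_mem_RM r n
  add_mem' := add_mem_RM
  neg_mem' {f} hf := by
    have : -f = f := neg_eq_of_add_eq_zero_left (vec_add_self f)
    rwa [this]

/-- The truth table of the product of the variables in `l`. -/
def monoTable : List (Fin 6) → ℕ
  | [] => 2 ^ 64 - 1
  | i :: l => ctrlMask i 6 6 &&& monoTable l

theorem ofTable_monoTable (l : List (Fin 6)) (x : Fin 6 → ZMod 2) :
    ofTable (monoTable l) x = (l.map x).prod := by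
  induction l with
  | nil =>
    have h := pointIdx_lt x 6
    have h' : (2 ^ 64 - 1).testBit (pointIdx x 6) = true := by
      rw [Nat.testBit_two_pow_sub_one]
      exact decide_eq_true (by omega)
    simp only [monoTable, ofTable, bitF2, h', if_true, List.map_nil, List.prod_nil]
  | cons i l ih =>
    have h : ofTable (ctrlMask i 6 6) x = x i := by
      have hM := testBit_ctrlMask (i := i) (j := 6) (n := 6) (by have := i.isLt; omega)
        (pointIdx_lt x 6)
      rw [← testBit_pointIdx x i.isLt]
      simp only [i.isLt, forall_const, lt_irrefl, false_imp_iff, and_true] at hM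
      simp only [ofTable, bitF2, hM]
    rw [List.map_cons, List.prod_cons, ← ih, ← h]
    exact bitF2_and _ _ _

/-- The function whose truth table is the sum of the `m k` over the bits `k < n` of `c`. -/
def lin (n : ℕ) (m : ℕ → ℕ) (c : ℕ) : BF 6 :=
  ∑ k ∈ Finset.range n, fun x => bitF2 c k * ofTable (m k) x

theorem lin_xor (n : ℕ) (m : ℕ → ℕ) (a b : ℕ) : lin n m (a ^^^ b) = lin n m a + lin n m b := by
  rw [lin, lin, lin, ← Finset.sum_add_distrib]
  refine Finset.sum_congr rfl fun k _ => ?_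
  funext x
  rw [Pi.add_apply, bitF2_xor, add_mul]

theorem lin_two_pow {n k : ℕ} (m : ℕ → ℕ) (hk : k < n) : lin n m (2 ^ k) = ofTable (m k) := by
  rw [lin, Finset.sum_eq_single_of_mem k (Finset.mem_range.2 hk)]
  · funext x; simp [bitF2]
  · intro l _ hl
    have : ¬ k = l := fun e => hl e.symm
    funext x; simp [bitF2, this]

theorem lin_zero (n : ℕ) (m : ℕ → ℕ) : lin n m 0 = 0 := by
  rw [lin]
  refine Finset.sum_eq_zero fun k _ => ?_
  funext x; simp [bitF2]

/-- If every squarefree monomial of degree at most `d` lies in `G` or among the `m k`, then every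
function of degree at most `d` is a sum of some `m k` and an element of `G`. -/
theorem exists_eq_lin_add {d n : ℕ} {m : ℕ → ℕ} (G : AddSubgroup (BF 6))
    (hm : ∀ s : Finset (Fin 6), s.card ≤ d → (fun x => ∏ i ∈ s, x i) ∈ G ∨
      ∃ k < n, ofTable (m k) = fun x => ∏ i ∈ s, x i)
    {f : BF 6} (hf : f ∈ RM d 6) : ∃ c < 2 ^ n, ∃ g ∈ G, f = lin n m c + g := by
  let D : AddSubmonoid (BF 6) :=
    { carrier := {f | ∃ c < 2 ^ n, ∃ g ∈ G, f = lin n m c + g}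
      zero_mem' := ⟨0, by positivity, 0, G.zero_mem, by simp [lin_zero]⟩
      add_mem' := by
        rintro _ _ ⟨a, ha, g, hg, rfl⟩ ⟨b, hb, h, hh, rfl⟩
        exact ⟨a ^^^ b, Nat.xor_lt_two_pow ha hb, g + h, G.add_mem hg hh, by
          rw [lin_xor, add_add_add_comm]⟩ }
  have hmono (s : Finset (Fin 6)) (hs : s.card ≤ d) : (fun x => ∏ i ∈ s, x i) ∈ D := by
    rcases hm s hs with h | ⟨k, hk, h⟩
    · exact ⟨0, by positivity, _, h, by simp [lin_zero]⟩
    · exact ⟨2 ^ k, Nat.pow_lt_pow_right (by norm_num) hk, 0, G.zero_mem, by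
        rw [lin_two_pow m hk, h, add_zero]⟩
  obtain ⟨p, hp, he⟩ := hf
  have : f = ∑ s ∈ p.support, fun x => p.coeff s * ∏ i ∈ s.support, x i := by
    funext x
    rw [he, MvPolynomial.eval_eq', Finset.sum_apply]
    refine Finset.sum_congr rfl fun s _ => ?_
    congr 1
    rw [← Finset.prod_subset (Finset.subset_univ s.support)]
    · refine Finset.prod_congr rfl fun i hi => ?_
      rcases zmod_two_cases (x i) with e | e
      · rw [e, zero_pow (Finsupp.mem_support_iff.1 hi)]
      · rw [e, one_pow]
    · intro i _ hi
      rw [Finsupp.notMem_support_iff.1 hi, pow_zero]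
  change f ∈ D
  rw [this]
  refine D.sum_mem fun s hs => ?_
  rcases zmod_two_cases (p.coeff s) with e | e
  · simp only [e, zero_mul]; exact D.zero_mem
  · simp only [e, one_mul]
    refine hmono _ (le_trans ?_ ((MvPolynomial.le_totalDegree hs).trans hp))
    rw [Finsupp.sum, Finset.card_eq_sum_ones]
    exact Finset.sum_le_sum fun i hi => Nat.one_le_iff_ne_zero.2 (Finsupp.mem_support_iff.1 hi)

theorem prod_mem_RM {s : Finset (Fin 6)} {d : ℕ} (hs : s.card ≤ d) :
    (fun x => ∏ i ∈ s, x i) ∈ RM d 6 := by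
  refine ⟨∏ i ∈ s, MvPolynomial.X i, ?_, fun x => by simp⟩
  refine (MvPolynomial.totalDegree_finsetProd _ _).trans ?_
  simpa [MvPolynomial.totalDegree_X] using hs

/-- The truth tables of the squarefree monomials of degree `d`. -/
def monoTables (d : ℕ) : List ℕ := (([0, 1, 2, 3, 4, 5] : List (Fin 6)).sublistsLen d).map monoTable

theorem exists_mem_monoTables (s : Finset (Fin 6)) :
    ∃ v ∈ monoTables s.card, ofTable v = fun x => ∏ i ∈ s, x i := by
  let l : List (Fin 6) := [0, 1, 2, 3, 4, 5]
  have hl : (l.filter (· ∈ s)).Nodup := List.Nodup.filter _ (by decide)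
  have hs : (l.filter (· ∈ s)).toFinset = s := by
    ext i
    have : i ∈ l := by revert i; decide
    simp [this]
  refine ⟨monoTable (l.filter (· ∈ s)), List.mem_map_of_mem (List.mem_sublistsLen.2
    ⟨List.filter_sublist, ?_⟩), ?_⟩
  · rw [← List.toFinset_card_of_nodup hl, hs]
  · funext x
    rw [ofTable_monoTable, ← List.prod_toFinset x hl, hs]

theorem exists_getD_of_mem {l : List ℕ} {v : ℕ} (h : v ∈ l) : ∃ k < l.length, l.getD k 0 = v := by
  obtain ⟨k, hk, e⟩ := List.getElem_of_mem h
  exact ⟨k, hk, by rw [List.getD_eq_getElem _ _ hk, e]⟩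

/-- The `k`-th squarefree monomial of degree `d`, as a truth table. -/
def monoAt (d k : ℕ) : ℕ := (monoTables d).getD k 0

theorem exists_eq_lin_monoAt_add {r : ℕ} {f : BF 6} (hf : f ∈ RM (r + 1) 6) :
    ∃ c < 2 ^ (monoTables (r + 1)).length, ∃ g ∈ RM r 6,
      f = lin (monoTables (r + 1)).length (monoAt (r + 1)) c + g := by
  refine exists_eq_lin_add (RMGroup r 6) (fun s hs => ?_) hf
  rcases Nat.lt_or_ge r s.card with h | h
  · obtain ⟨v, hv, e⟩ := exists_mem_monoTables s
    rw [show s.card = r + 1 by omega] at hv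
    obtain ⟨k, hk, e'⟩ := exists_getD_of_mem hv
    exact Or.inr ⟨k, hk, by rw [monoAt, e', e]⟩
  · exact Or.inl (prod_mem_RM h)

theorem mem_RM_of_card (f : BF 6) : f ∈ RM 6 6 := by
  refine ⟨∑ a : Fin 6 → ZMod 2, MvPolynomial.C (f a) *
    ∏ i, (MvPolynomial.X i + MvPolynomial.C (a i + 1)), ?_, fun x => ?_⟩
  · refine MvPolynomial.totalDegree_finsetSum_le fun a _ => ?_
    refine (MvPolynomial.totalDegree_mul _ _).trans ?_
    rw [MvPolynomial.totalDegree_C, zero_add]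
    refine (MvPolynomial.totalDegree_finsetProd _ _).trans ?_
    refine (Finset.sum_le_card_nsmul _ _ 1 fun i _ => ?_).trans (by simp)
    exact (MvPolynomial.totalDegree_add _ _).trans (max_le (by rw [MvPolynomial.totalDegree_X])
      (by rw [MvPolynomial.totalDegree_C]; omega))
  · simp only [map_sum, map_mul, map_prod, map_add, MvPolynomial.eval_C, MvPolynomial.eval_X]
    rw [Finset.sum_eq_single x]
    · have (i : Fin 6) : x i + (x i + 1) = 1 := by
        rcases zmod_two_cases (x i) with e | e <;> rw [e] <;> decide
      simp [this]
    · intro a _ ha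
      obtain ⟨i, hi⟩ := Function.ne_iff.1 ha
      rw [Finset.prod_eq_zero (Finset.mem_univ i), mul_zero]
      rcases zmod_two_cases (x i) with e | e <;> rcases zmod_two_cases (a i) with e' | e' <;>
        simp_all <;> decide
    · simp

/-! ### Closing a set of functions under affine maps -/

theorem ctrlFlip_xor (n i j a b : ℕ) :
    ctrlFlip n i j (a ^^^ b) = ctrlFlip n i j a ^^^ ctrlFlip n i j b ^^^ ctrlFlip n i j 0 := by
  apply Nat.eq_of_testBit_eq
  intro k
  apply bitF2_inj
  simp only [bitF2_xor, bitF2_ctrlFlip]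
  generalize bitF2 a k = u, bitF2 b k = v, bitF2 a i = u', bitF2 b i = v'
  have h : bitF2 0 k = 0 ∧ bitF2 0 i = 0 := by simp [bitF2]
  rw [h.1, h.2]
  split_ifs <;> revert u v u' v' <;> decide

theorem ctrlFlipList_xor (n : ℕ) (os : List (ℕ × ℕ)) (a b : ℕ) :
    ctrlFlipList n os (a ^^^ b) = ctrlFlipList n os a ^^^ ctrlFlipList n os b ^^^
      ctrlFlipList n os 0 := by
  induction os with
  | nil => simp [ctrlFlipList]
  | cons o os ih =>
    simp only [ctrlFlipList]
    rw [ih, ctrlFlip_xor, ctrlFlip_xor]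
    generalize ctrlFlip n o.1 o.2 0 = z
    apply Nat.eq_of_testBit_eq
    intro k
    simp only [Nat.testBit_xor]
    cases z.testBit k <;> simp

/-- The truth table of `lin n m c`. -/
def linTable (m : ℕ → ℕ) (c : ℕ) : ℕ → ℕ
  | 0 => 0
  | n + 1 => linTable m c n ^^^ if c.testBit n = true then m n else 0

theorem ofTable_linTable (m : ℕ → ℕ) (c n : ℕ) : ofTable (linTable m c n) = lin n m c := by
  induction n with
  | zero => simp [linTable, lin, ofTable_zero]
  | succ n ih =>
    rw [linTable, ofTable_xor, ih, lin, lin, Finset.sum_range_succ]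
    congr 1
    funext x
    split_ifs with h
    · simp [bitF2, h]
    · simp [bitF2, h, ofTable]

theorem induction_xor {n : ℕ} {Q : ℕ → Prop} (h0 : Q 0) (h2 : ∀ k < n, Q (2 ^ k))
    (hx : ∀ a b, Q a → Q b → Q (a ^^^ b)) {c : ℕ} (hc : c < 2 ^ n) : Q c := by
  induction n generalizing c with
  | zero =>
    obtain rfl : c = 0 := by simpa using hc
    exact h0
  | succ n ih =>
    have ih' := @ih fun k hk => h2 k (by omega)
    by_cases hb : c.testBit n = true
    · have hp := xor_two_pow_of_testBit hb
      have : c ^^^ 2 ^ n < 2 ^ n := by rw [hp.2]; rw [pow_succ] at hc; omega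
      have := hx _ _ (ih' this) (h2 n (by omega))
      rwa [Nat.xor_assoc, Nat.xor_self, Nat.xor_zero] at this
    · have := testBit_top hc
      rw [this] at hb
      exact ih' (by simpa using hb)

/-- Invariance of a property of Boolean functions under addition of elements of `RM(r,6)` and
under affine changes of coordinates. -/
structure AffineInvariant (r : ℕ) (P : BF 6 → Prop) : Prop where
  of_add : ∀ f, ∀ g ∈ RM r 6, P (f + g) → P f
  of_comp : ∀ f t, IsAffine t → P (f ∘ t) → P f

/-- The property that all functions in the coset `f + RM(r,6)` satisfy `P`. -/
def OnCoset (r : ℕ) (P : BF 6 → Prop) (f : BF 6) : Prop := ∀ g ∈ RM r 6, P (f + g)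

theorem AffineInvariant.onCoset {s r : ℕ} {P : BF 6 → Prop} (hP : AffineInvariant s P) :
    AffineInvariant r (OnCoset r P) where
  of_add f g hg h k hk := by
    have := h (g + k) (add_mem_RM hg hk)
    rwa [add_assoc, ← add_assoc g, vec_add_self, zero_add] at this
  of_comp f t ht h k hk := hP.of_comp _ t ht (h (k ∘ t) (comp_mem_RM hk ht))

theorem AffineInvariant.transfer {r : ℕ} {P : BF 6 → Prop} (hP : AffineInvariant r P) {f g : BF 6}
    {t : (Fin 6 → ZMod 2) → Fin 6 → ZMod 2} (ht : IsAffine t) (h : f ∘ t + g ∈ RM r 6) (hf : P f) :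
    P g := by
  obtain ⟨s, hs, hts, -⟩ := ht.exists_inverse
  have h1 : P (f ∘ t) := hP.of_comp _ s hs (by rwa [Function.comp_assoc, hts, Function.comp_id])
  refine hP.of_add g (f ∘ t + g) h ?_
  rwa [add_left_comm, vec_add_self, add_zero]

/-- A pair `(T, p)` passes this test if, modulo `RM(r,6)`, the change of coordinates described by
`T` acts on the functions with truth table `q + ∑ c_k m_k` as `p` acts on the vectors `c`. -/
def generatorTest (r n q : ℕ) (m : ℕ → ℕ) (T p : List (ℕ × ℕ)) : Bool :=
  T.all (fun o => o.1 != o.2 && Nat.blt o.2 6) && p.all (fun o => o.1 != o.2 && Nat.blt o.2 n) &&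
    evalFirst (fun z =>
      degLtTest (r + 1) 6 (permBitsList 6 T (q ^^^ linTable m z n) ^^^ q) &&
      (List.range n).all fun k =>
        degLtTest (r + 1) 6 (permBitsList 6 T (linTable m (z ^^^ ctrlFlipList n p (2 ^ k)) n) ^^^ m k))
      (ctrlFlipList n p 0)

theorem validOps_of_all {n : ℕ} {T : List (ℕ × ℕ)}
    (h : T.all (fun o => o.1 != o.2 && Nat.blt o.2 n) = true) : ValidOps n T := by
  intro o ho
  have := List.all_eq_true.1 h o ho
  rw [Bool.and_eq_true, bne_iff_ne, Nat.blt_eq] at this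
  exact this

theorem AffineInvariant.of_generatorTest {r n q : ℕ} {m : ℕ → ℕ} {T p : List (ℕ × ℕ)}
    {P : BF 6 → Prop} (hP : AffineInvariant r P) (h : generatorTest r n q m T p = true) {c : ℕ}
    (hc : c < 2 ^ n) (hPc : P (ofTable q + lin n m (ctrlFlipList n p c))) :
    P (ofTable q + lin n m c) := by
  rw [generatorTest, evalFirst_eq, Bool.and_eq_true, Bool.and_eq_true, Bool.and_eq_true] at h
  obtain ⟨⟨hT, -⟩, hq, hm⟩ := h
  obtain ⟨t, ht, htab⟩ := exists_ofTable_permBitsList (validOps_of_all hT)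
  rw [List.all_eq_true] at hm
  have hq' := ofTable_mem_RM hq
  rw [ofTable_xor, htab, ofTable_xor, ofTable_linTable] at hq'
  have hlin : lin n m (ctrlFlipList n p 0 ^^^ ctrlFlipList n p c) ∘ t + lin n m c ∈ RM r 6 := by
    refine induction_xor (Q := fun c =>
      lin n m (ctrlFlipList n p 0 ^^^ ctrlFlipList n p c) ∘ t + lin n m c ∈ RM r 6)
      ?_ (fun k hk => ?_) (fun a b ha hb => ?_) hc
    · rw [Nat.xor_self, lin_zero, add_zero]
      exact zero_mem_RM r 6
    · have := ofTable_mem_RM (hm k (List.mem_range.2 hk))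
      rwa [ofTable_xor, htab, ofTable_linTable, ← lin_two_pow m hk] at this
    · have e : ctrlFlipList n p 0 ^^^ ctrlFlipList n p (a ^^^ b) =
          (ctrlFlipList n p 0 ^^^ ctrlFlipList n p a) ^^^
            (ctrlFlipList n p 0 ^^^ ctrlFlipList n p b) := by
        rw [ctrlFlipList_xor]
        generalize ctrlFlipList n p 0 = z
        apply Nat.eq_of_testBit_eq
        intro k
        simp only [Nat.testBit_xor]
        cases z.testBit k <;> simp
      rw [e, lin_xor n m (ctrlFlipList n p 0 ^^^ ctrlFlipList n p a), lin_xor n m a]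
      have := add_mem_RM ha hb
      rwa [add_add_add_comm] at this
  refine hP.transfer ht ?_ hPc
  have := add_mem_RM hq' hlin
  rw [lin_xor] at this
  convert this using 1
  generalize lin n m (ctrlFlipList n p 0) = z
  funext x
  simp only [Pi.add_apply, Function.comp_apply]
  generalize z (t x) = z', ofTable q x = q', ofTable q (t x) = q'', lin n m c x = l,
    lin n m (ctrlFlipList n p c) (t x) = l'
  revert z' q' q'' l l'
  decide

/-- Enlarge a set of `n`-bit vectors by its images under the listed generators. -/
def enlarge (n : ℕ) (gens : List (List (ℕ × ℕ) × List (ℕ × ℕ))) : List ℕ → ℕ → ℕ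
  | [], S => S
  | i :: is, S =>
    evalFirst (enlarge n gens is) (S ||| permBitsList n (gens.getD i ([], [])).2 S)

/-- The set of bit vectors in a list. -/
def setBits : List ℕ → ℕ
  | [] => 0
  | c :: cs => setBits cs ||| 1 <<< c

theorem mem_of_testBit_setBits {l : List ℕ} {c : ℕ} (h : (setBits l).testBit c = true) :
    c ∈ l := by
  induction l with
  | nil => simp [setBits] at h
  | cons a l ih =>
    rw [setBits, Nat.testBit_or, Bool.or_eq_true, Nat.one_shiftLeft, Nat.testBit_two_pow] at h
    rcases h with h | h
    · exact List.mem_cons_of_mem _ (ih h)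
    · rw [← of_decide_eq_true h]
      exact List.mem_cons_self

/-- The listed generators are valid and the enlargement of `l` contains all `n`-bit vectors. -/
def closureTest (r n q : ℕ) (m : ℕ → ℕ) (gens : List (List (ℕ × ℕ) × List (ℕ × ℕ)))
    (is l : List ℕ) : Bool :=
  gens.all (fun g => generatorTest r n q m g.1 g.2) &&
    (evalFirst (enlarge n gens is) (setBits l) == 2 ^ 2 ^ n - 1)

theorem AffineInvariant.of_enlarge {r n q : ℕ} {m : ℕ → ℕ} {P : BF 6 → Prop}
    (hP : AffineInvariant r P) {gens : List (List (ℕ × ℕ) × List (ℕ × ℕ))}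
    (hg : ∀ g ∈ gens, generatorTest r n q m g.1 g.2 = true) (is : List ℕ) {S : ℕ}
    (hS : ∀ c < 2 ^ n, S.testBit c = true → P (ofTable q + lin n m c)) :
    ∀ c < 2 ^ n, (enlarge n gens is S).testBit c = true → P (ofTable q + lin n m c) := by
  induction is generalizing S with
  | nil => exact hS
  | cons i is ih =>
    rw [enlarge, evalFirst_eq]
    refine ih fun c hc h => ?_
    rw [Nat.testBit_or, Bool.or_eq_true] at h
    rcases h with h | h
    · exact hS c hc h
    by_cases hi : i < gens.length
    · rw [List.getD_eq_getElem _ _ hi] at h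
      have hgi := hg _ (List.getElem_mem hi)
      have hv : ValidOps n gens[i].2 := by
        rw [generatorTest, Bool.and_eq_true, Bool.and_eq_true] at hgi
        exact validOps_of_all hgi.1.2
      rw [testBit_permBitsList hv hc] at h
      exact hP.of_generatorTest hgi hc (hS _ (ctrlFlipList_lt hv hc) h)
    · rw [List.getD_eq_default _ _ (by omega)] at h
      exact hS c hc h

theorem AffineInvariant.onCoset_of_closureTest {r n q : ℕ} {P : BF 6 → Prop}
    (hP : AffineInvariant r P) (hn : (monoTables (r + 1)).length = n)
    {gens : List (List (ℕ × ℕ) × List (ℕ × ℕ))} {is l : List ℕ}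
    (h : closureTest r n q (monoAt (r + 1)) gens is l = true)
    (hl : ∀ c ∈ l, P (ofTable q + ofTable (linTable (monoAt (r + 1)) c n))) :
    OnCoset (r + 1) P (ofTable q) := by
  intro g hg
  obtain ⟨c, hc, k, hk, rfl⟩ := exists_eq_lin_monoAt_add hg
  rw [hn] at hc ⊢
  rw [closureTest, evalFirst_eq, Bool.and_eq_true, List.all_eq_true, beq_iff_eq] at h
  have h' := hP.of_enlarge h.1 is (S := setBits l)
    (fun c _ h => by rw [← ofTable_linTable]; exact hl c (mem_of_testBit_setBits h)) c hc
  rw [h.2, Nat.testBit_two_pow_sub_one] at h'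
  refine hP.of_add _ k hk ?_
  rw [← add_assoc, add_assoc, vec_add_self, add_zero]
  exact h' (decide_eq_true hc)

/-! ### Lower bounds for the second-order nonlinearity -/

/-- The set of all `c < 2 ^ n` such that the truth table of `lin n m c` has bit `p` set. -/
def parityPlane (m : ℕ → ℕ) (p : ℕ) : ℕ → ℕ
  | 0 => 0
  | n + 1 =>
    evalFirst (fun w =>
      w ||| (if (m n).testBit p = true then w ^^^ (2 ^ 2 ^ n - 1) else w) <<< 2 ^ n)
      (parityPlane m p n)

theorem parityPlane_lt (m : ℕ → ℕ) (p n : ℕ) : parityPlane m p n < 2 ^ 2 ^ n := by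
  induction n with
  | zero => simp [parityPlane]
  | succ n ih =>
    rw [parityPlane, evalFirst_eq, show 2 ^ (n + 1) = 2 ^ n + 2 ^ n by ring]
    refine Nat.or_lt_two_pow (ih.trans_le (Nat.pow_le_pow_right (by norm_num) (Nat.le_add_left _ _)))
      (Nat.shiftLeft_lt ?_)
    split_ifs
    · exact Nat.xor_lt_two_pow ih (Nat.sub_lt (by positivity) one_pos)
    · exact ih

theorem linTable_congr (m : ℕ → ℕ) {a b n : ℕ} (h : ∀ k < n, a.testBit k = b.testBit k) :
    linTable m a n = linTable m b n := by
  induction n with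
  | zero => rfl
  | succ n ih =>
    rw [linTable, linTable, ih fun k hk => h k (by omega), h n (by omega)]

theorem testBit_parityPlane (m : ℕ → ℕ) (p : ℕ) {n c : ℕ} (hc : c < 2 ^ n) :
    (parityPlane m p n).testBit c = (linTable m c n).testBit p := by
  induction n generalizing c with
  | zero => simp [parityPlane, linTable]
  | succ n ih =>
    have h2 : 2 ^ (n + 1) = 2 ^ n + 2 ^ n := by ring
    have htop := testBit_top hc
    rw [parityPlane, evalFirst_eq, Nat.testBit_or, Nat.testBit_shiftLeft, linTable, htop,
      Nat.testBit_xor]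
    by_cases hl : 2 ^ n ≤ c
    · have hz : (parityPlane m p n).testBit c = false := Nat.testBit_lt_two_pow
        ((parityPlane_lt m p n).trans_le (Nat.pow_le_pow_right (by norm_num) hl))
      rw [hz, linTable_congr m (b := c - 2 ^ n) fun k hk => (testBit_sub_top hl hk).symm,
        ← ih (c := c - 2 ^ n) (by omega)]
      have hlt : c - 2 ^ n < 2 ^ n := by omega
      split_ifs with hb hd
      · simp [hl, Nat.testBit_xor, hb, hlt]
      · simp [hl] at hd
      · simp [hl, hb]
      · simp [hl] at *
    · simp [hl, ih (c := c) (by omega)]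

/-- Add one bit to every counter of a family of saturating counters, where bit `c` of the `k`-th
entry of the list is the `k`-th binary digit of the counter number `c`. -/
def addBit : List ℕ → ℕ → List ℕ
  | [], _ => []
  | [s], b => [s ||| b]
  | x :: y :: l, b => (x ^^^ b) :: addBit (y :: l) (x &&& b)

/-- The value of the counter number `c`. -/
def counterValue (c : ℕ) : List ℕ → ℕ
  | [] => 0
  | x :: l => (x.testBit c).toNat + 2 * counterValue c l

theorem counterValue_addBit_le (c : ℕ) (l : List ℕ) (b : ℕ) :
    counterValue c (addBit l b) ≤ counterValue c l + (b.testBit c).toNat := by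
  induction l generalizing b with
  | nil => simp [addBit, counterValue]
  | cons x l ih =>
    cases l with
    | nil =>
      rw [addBit]
      simp only [counterValue, Nat.testBit_or]
      cases x.testBit c <;> cases b.testBit c <;> simp
    | cons y l =>
      have := ih (x &&& b)
      rw [addBit, counterValue]
      rw [counterValue]
      rw [Nat.testBit_and] at this
      rw [Nat.testBit_xor]
      revert this
      cases x.testBit c <;> cases b.testBit c <;> simp <;> omega

theorem le_counterValue (c i : ℕ) (l : List ℕ) (h : (l.getD i 0).testBit c = true) :
    2 ^ i ≤ counterValue c l := by
  induction l generalizing i with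
  | nil => simp at h
  | cons x l ih =>
    cases i with
    | zero =>
      have : x.testBit c = true := h
      simp [counterValue, this]
    | succ i =>
      have := ih i h
      rw [counterValue, pow_succ]
      omega

/-- Counters for the weights of the functions with truth table `v` plus `lin n m c`. -/
def weightPlanes (n : ℕ) (m : ℕ → ℕ) (v : ℕ) (start : List ℕ) : ℕ → List ℕ
  | 0 => start
  | k + 1 => addBit (weightPlanes n m v start k)
      (if v.testBit k = true then parityPlane m k n ^^^ (2 ^ 2 ^ n - 1) else parityPlane m k n)

theorem counterValue_weightPlanes_le {n : ℕ} (m : ℕ → ℕ) (v : ℕ) (start : List ℕ) (k : ℕ) {c : ℕ}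
    (hc : c < 2 ^ n) : counterValue c (weightPlanes n m v start k) ≤
      counterValue c start + tableWeight (v ^^^ linTable m c n) k := by
  induction k with
  | zero => simp [weightPlanes]
  | succ k ih =>
    rw [weightPlanes, tableWeight, Nat.testBit_xor, ← testBit_parityPlane m k hc]
    refine (counterValue_addBit_le _ _ _).trans ?_
    rw [← add_assoc]
    refine Nat.add_le_add ih (le_of_eq ?_)
    split_ifs with h
    · simp [h, Nat.testBit_xor, hc]
    · simp [h]

/-- The truth tables of all squarefree monomials of degree at most two. -/
def quadTable (k : ℕ) : ℕ := (monoTables 0 ++ monoTables 1 ++ monoTables 2).getD k 0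

theorem exists_eq_lin_quadTable {g : BF 6} (hg : g ∈ RM 2 6) :
    ∃ c < 2 ^ 22, g = lin 22 quadTable c := by
  obtain ⟨c, hc, k, hk, rfl⟩ := exists_eq_lin_add (n := 22) (m := quadTable) ⊥ (fun s hs => by
    obtain ⟨v, hv, e⟩ := exists_mem_monoTables s
    have hmem : v ∈ monoTables 0 ++ monoTables 1 ++ monoTables 2 := by
      have : s.card = 0 ∨ s.card = 1 ∨ s.card = 2 := by omega
      rcases this with h | h | h <;> rw [h] at hv <;> simp [hv]
    obtain ⟨k, hk, e'⟩ := exists_getD_of_mem hmem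
    exact Or.inr ⟨k, hk, by rw [quadTable, e', e]⟩) hg
  rw [AddSubgroup.mem_bot] at hk
  exact ⟨c, hc, by rw [hk, add_zero]⟩

/-- The counters, all started at `s`, count to sixteen for each quadratic function. -/
def lowerTest (v : ℕ) (s : Bool) : Bool :=
  (weightPlanes 22 quadTable v [if s then 2 ^ 2 ^ 22 - 1 else 0, 0, 0, 0, 0] 64).getD 4 0 ==
    2 ^ 2 ^ 22 - 1

theorem le_hd_of_lowerTest {v : ℕ} {s : Bool} (h : lowerTest v s = true) {g : BF 6}
    (hg : g ∈ RM 2 6) : 16 ≤ hd (ofTable v) g + s.toNat := by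
  obtain ⟨c, hc, rfl⟩ := exists_eq_lin_quadTable hg
  have h1 : 16 ≤ _ := le_counterValue c 4 _ (by
    rw [beq_iff_eq.1 h, Nat.testBit_two_pow_sub_one]
    exact decide_eq_true hc)
  have h2 := h1.trans (counterValue_weightPlanes_le _ _ _ _ hc)
  rw [← ofTable_linTable, hd_ofTable, add_comm]
  refine h2.trans (Nat.add_le_add_right ?_ _)
  cases s
  · simp [counterValue]
  · generalize 2 ^ 2 ^ 22 - 1 = z
    simpa [counterValue] using Bool.toNat_le _

/-! ### Invariance of the higher-order nonlinearity -/

theorem nl_le_hd {r n : ℕ} (f : BF n) {g : BF n} (hg : g ∈ RM r n) : nl r f ≤ hd f g :=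
  Nat.sInf_le ⟨g, hg, rfl⟩

theorem exists_nl_eq_hd (r : ℕ) {n : ℕ} (f : BF n) : ∃ g ∈ RM r n, nl r f = hd f g :=
  Nat.sInf_mem (s := {d | ∃ g ∈ RM r n, d = hd f g}) ⟨_, 0, zero_mem_RM r n, rfl⟩

theorem hd_add_right {n : ℕ} (f g h : BF n) : hd (f + h) (g + h) = hd f g := by
  simp [hd]

theorem hd_comp {n : ℕ} (f g : BF n) {s t : (Fin n → ZMod 2) → Fin n → ZMod 2}
    (hts : t ∘ s = id) (hst : s ∘ t = id) : hd (f ∘ t) (g ∘ t) = hd f g := by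
  refine Finset.card_bij' (fun x _ => t x) (fun x _ => s x) ?_ ?_ ?_ ?_
  · intro x hx
    simpa using hx
  · intro x hx
    have : t (s x) = x := congrFun hts x
    simpa [this] using hx
  · exact fun x _ => congrFun hst x
  · exact fun x _ => congrFun hts x

theorem nl_add {r n : ℕ} (f : BF n) {g : BF n} (hg : g ∈ RM r n) : nl r (f + g) = nl r f := by
  have key (f : BF n) : nl r (f + g) ≤ nl r f := by
    obtain ⟨h, hh, e⟩ := exists_nl_eq_hd r f
    rw [e, ← hd_add_right f h g]
    exact nl_le_hd _ (add_mem_RM hh hg)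
  refine (key f).antisymm ?_
  simpa only [add_assoc, vec_add_self, add_zero] using key (f + g)

theorem nl_comp {r n : ℕ} (f : BF n) {t : (Fin n → ZMod 2) → Fin n → ZMod 2} (ht : IsAffine t) :
    nl r (f ∘ t) = nl r f := by
  have key (f : BF n) {t : (Fin n → ZMod 2) → Fin n → ZMod 2} (ht : IsAffine t) :
      nl r (f ∘ t) ≤ nl r f := by
    obtain ⟨s, -, hts, hst⟩ := ht.exists_inverse
    obtain ⟨h, hh, e⟩ := exists_nl_eq_hd r f
    rw [e, ← hd_comp f h hts hst]
    exact nl_le_hd _ (comp_mem_RM hh ht)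
  obtain ⟨s, hs, hts, -⟩ := ht.exists_inverse
  refine (key f ht).antisymm ?_
  simpa only [Function.comp_assoc, hts, Function.comp_id] using key (f ∘ t) hs

theorem affineInvariant_nl_eq (r k : ℕ) : AffineInvariant r fun f => nl r f = k where
  of_add f g hg h := by rwa [nl_add f hg] at h
  of_comp f t ht h := by rwa [nl_comp f ht] at h

theorem affEquivMod_iff {r n : ℕ} {f h : BF n} :
    AffEquivMod r n f h ↔ ∃ t, IsAffine t ∧ f + h ∘ t ∈ RM r n := by
  constructor
  · rintro ⟨A, hA, b, hf⟩
    exact ⟨fun x => A.mulVec x + b, ⟨A, hA, b, fun _ => rfl⟩, hf⟩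
  · rintro ⟨t, ⟨A, hA, b, ht⟩, hf⟩
    refine ⟨A, hA, b, ?_⟩
    obtain rfl : t = fun x => A.mulVec x + b := funext ht
    exact hf

theorem affineInvariant_affEquivMod (r : ℕ) (h : BF 6) :
    AffineInvariant r fun f => AffEquivMod r 6 f h where
  of_add f g hg H := by
    obtain ⟨t, ht, hf⟩ := affEquivMod_iff.1 H
    refine affEquivMod_iff.2 ⟨t, ht, ?_⟩
    have := add_mem_RM hf hg
    rwa [add_right_comm, add_assoc f, vec_add_self, add_zero] at this
  of_comp f t ht H := by
    obtain ⟨s, hs, hts, -⟩ := ht.exists_inverse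
    obtain ⟨u, hu, hf⟩ := affEquivMod_iff.1 H
    refine affEquivMod_iff.2 ⟨u ∘ s, hu.comp hs, ?_⟩
    have : (f ∘ t + h ∘ u) ∘ s ∈ RM r 6 := comp_mem_RM hf hs
    change (f ∘ (t ∘ s)) + h ∘ (u ∘ s) ∈ RM r 6 at this
    rwa [hts, Function.comp_id] at this

/-- The functions `fun6`, ..., `fun12`. -/
def representatives : List (BF 6) := [fun6, fun7, fun8, fun9, fun10, fun11, fun12]

/-- Second-order nonlinearity 15 implies equivalence to a representative. -/
def Classified (f : BF 6) : Prop :=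
  nl 2 f = 15 → ∃ h ∈ representatives, AffEquivMod 2 6 f h

theorem affineInvariant_classified : AffineInvariant 2 Classified where
  of_add f g hg H hf := by
    obtain ⟨h, hh, e⟩ := H (by rwa [nl_add f hg])
    exact ⟨h, hh, (affineInvariant_affEquivMod 2 h).of_add f g hg e⟩
  of_comp f t ht H hf := by
    obtain ⟨h, hh, e⟩ := H (by rwa [nl_comp f ht])
    exact ⟨h, hh, (affineInvariant_affEquivMod 2 h).of_comp f t ht e⟩

theorem nl_le_tableWeight {v w : ℕ} (h : degLtTest 3 6 (w ^^^ v) = true) :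
    nl 2 (ofTable v) ≤ tableWeight w 64 := by
  refine (nl_le_hd _ (ofTable_mem_RM h)).trans (le_of_eq ?_)
  rw [hd_ofTable, Nat.xor_comm w, ← Nat.xor_assoc, Nat.xor_self, Nat.zero_xor]

theorem eq_ofTable {f : BF 6} {v : ℕ} (h : ∀ k < 64, f (bitPoint k) = bitF2 v k) :
    f = ofTable v := by
  funext x
  have := h _ (pointIdx_lt x 6)
  rwa [bitPoint_pointIdx] at this

theorem nl_eq_fifteen {v : ℕ} (w : ℕ) (h : degLtTest 3 6 (w ^^^ v) = true)
    (hw : tableWeight w 64 = 15) (hv : lowerTest v true = true) : nl 2 (ofTable v) = 15 := by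
  refine le_antisymm (hw ▸ nl_le_tableWeight h) ?_
  obtain ⟨g, hg, e⟩ := exists_nl_eq_hd 2 (ofTable v)
  have : 16 ≤ hd (ofTable v) g + 1 := le_hd_of_lowerTest hv hg
  omega

theorem classified_of_lowerTest {v : ℕ} (h : lowerTest v false = true) :
    Classified (ofTable v) := by
  intro h15
  obtain ⟨g, hg, e⟩ := exists_nl_eq_hd 2 (ofTable v)
  have : 16 ≤ hd (ofTable v) g + 0 := le_hd_of_lowerTest h hg
  omega

theorem classified_of_light_word {v w : ℕ}
    (h : (degLtTest 3 6 (w ^^^ v) && Nat.blt (tableWeight w 64) 15) = true) :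
    Classified (ofTable v) := by
  intro h15
  rw [Bool.and_eq_true, Nat.blt_eq] at h
  have := nl_le_tableWeight h.1
  omega

theorem classified_of_reflection {v w : ℕ} (hw : ofTable w ∈ representatives)
    (h : degLtTest 3 6 (v ^^^ permBitsList 6 [(6, 0), (6, 1), (6, 2), (6, 3), (6, 4), (6, 5)] w) =
      true) : Classified (ofTable v) := by
  obtain ⟨t, ht, htab⟩ := exists_ofTable_permBitsList
    (os := [(6, 0), (6, 1), (6, 2), (6, 3), (6, 4), (6, 5)]) (validOps_of_all rfl)
  refine fun _ => ⟨_, hw, affEquivMod_iff.2 ⟨t, ht, ?_⟩⟩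
  have := ofTable_mem_RM h
  rwa [ofTable_xor, htab] at this

theorem onCoset_classified {q : ℕ} {gens : List (List (ℕ × ℕ) × List (ℕ × ℕ))} {is l : List ℕ}
    {ws : List (ℕ × ℕ)}
    (h : closureTest 2 20 q (monoAt 3) gens is (l ++ ws.map Prod.fst) = true)
    (hws : (ws.all fun z => degLtTest 3 6 (z.2 ^^^ (q ^^^ linTable (monoAt 3) z.1 20)) &&
      Nat.blt (tableWeight z.2 64) 15) = true)
    (hl : ∀ c ∈ l, Classified (ofTable (q ^^^ linTable (monoAt 3) c 20))) :
    OnCoset 3 Classified (ofTable q) := by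
  refine affineInvariant_classified.onCoset_of_closureTest rfl h fun c hc => ?_
  rw [← ofTable_xor]
  rcases List.mem_append.1 hc with hc | hc
  · exact hl c hc
  · obtain ⟨z, hz, rfl⟩ := List.mem_map.1 hc
    exact classified_of_light_word (List.all_eq_true.1 hws z hz)


/-! ### The representatives -/

theorem fun6_eq_ofTable : fun6 = ofTable 7505328529586831360 :=
  eq_ofTable (by decide +kernel)

theorem fun7_eq_ofTable : fun7 = ofTable 2109945805996589056 :=
  eq_ofTable (by decide +kernel)

theorem fun8_eq_ofTable : fun8 = ofTable 14312697726882578432 :=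
  eq_ofTable (by decide +kernel)

theorem fun9_eq_ofTable : fun9 = ofTable 1666355502744911872 :=
  eq_ofTable (by decide +kernel)

theorem fun10_eq_ofTable : fun10 = ofTable 4150665397693059072 :=
  eq_ofTable (by decide +kernel)

theorem fun11_eq_ofTable : fun11 = ofTable 1445889953410105344 :=
  eq_ofTable (by decide +kernel)

theorem fun12_eq_ofTable : fun12 = ofTable 2326197756613920768 :=
  eq_ofTable (by decide +kernel)

theorem nl_fun6 : nl 2 fun6 = 15 := by
  rw [fun6_eq_ofTable]
  exact nl_eq_fifteen 7505328529586831360 (by decide +kernel) (by decide +kernel) (by decide +kernel)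

theorem nl_fun7 : nl 2 fun7 = 15 := by
  rw [fun7_eq_ofTable]
  exact nl_eq_fifteen 2109945805996589056 (by decide +kernel) (by decide +kernel) (by decide +kernel)

theorem nl_fun8 : nl 2 fun8 = 15 := by
  rw [fun8_eq_ofTable]
  exact nl_eq_fifteen 455735475632619532 (by decide +kernel) (by decide +kernel) (by decide +kernel)

theorem nl_fun9 : nl 2 fun9 = 15 := by
  rw [fun9_eq_ofTable]
  exact nl_eq_fifteen 1666355502744911872 (by decide +kernel) (by decide +kernel) (by decide +kernel)

theorem nl_fun10 : nl 2 fun10 = 15 := by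
  rw [fun10_eq_ofTable]
  exact nl_eq_fifteen 4150665397693059072 (by decide +kernel) (by decide +kernel) (by decide +kernel)

theorem nl_fun11 : nl 2 fun11 = 15 := by
  rw [fun11_eq_ofTable]
  exact nl_eq_fifteen 1445889953410105344 (by decide +kernel) (by decide +kernel) (by decide +kernel)

theorem nl_fun12 : nl 2 fun12 = 15 := by
  rw [fun12_eq_ofTable]
  exact nl_eq_fifteen 2326197756613920768 (by decide +kernel) (by decide +kernel) (by decide +kernel)

/-! ### The classification -/

theorem onCoset_classified_1 : OnCoset 3 Classified (ofTable 1) := by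
  refine onCoset_classified (gens :=
    [([(0, 1)], [(4, 10), (5, 11), (6, 12), (7, 13), (8, 14), (9, 15)]), ([(0, 2)], [(1, 10), (2,
    11), (3, 12), (7, 16), (8, 17), (9, 18)]), ([(0, 3)], [(0, 10), (2, 13), (3, 14), (5, 16), (6,
    17), (9, 19)]), ([(0, 5)], [(0, 12), (1, 14), (2, 15), (4, 17), (5, 18), (7, 19)]), ([(1, 2)],
    [(1, 4), (2, 5), (3, 6), (13, 16), (14, 17), (15, 18)]), ([(1, 5)], [(0, 6), (1, 8), (2, 9),
    (10, 17), (11, 18), (13, 19)]), ([(2, 0)], [(10, 1), (11, 2), (12, 3), (16, 7), (17, 8), (18,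
    9)]), ([(2, 1)], [(4, 1), (5, 2), (6, 3), (16, 13), (17, 14), (18, 15)]), ([(2, 3)], [(0, 1),
    (5, 7), (6, 8), (11, 13), (12, 14), (18, 19)]), ([(2, 4)], [(0, 2), (4, 7), (6, 9), (10, 13),
    (12, 15), (17, 19)]), ([(3, 0)], [(10, 0), (13, 2), (14, 3), (16, 5), (17, 6), (19, 9)]),
    ([(3, 1)], [(4, 0), (7, 2), (8, 3), (16, 11), (17, 12), (19, 15)]), ([(3, 2)], [(1, 0), (7,
    5), (8, 6), (13, 11), (14, 12), (19, 18)]), ([(3, 4)], [(1, 2), (4, 5), (8, 9), (10, 11), (14,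
    15), (17, 18)]), ([(4, 1)], [(5, 0), (7, 1), (9, 3), (16, 10), (18, 12), (19, 14)]), ([(4,
    2)], [(2, 0), (7, 4), (9, 6), (13, 10), (15, 12), (19, 17)]), ([(4, 3)], [(2, 1), (5, 4), (9,
    8), (11, 10), (15, 14), (18, 17)]), ([(5, 0)], [(12, 0), (14, 1), (15, 2), (17, 4), (18, 5),
    (19, 7)]), ([(5, 1)], [(6, 0), (8, 1), (9, 2), (17, 10), (18, 11), (19, 13)]), ([(5, 2)], [(3,
    0), (8, 4), (9, 5), (14, 10), (15, 11), (19, 16)]), ([(5, 3)], [(3, 1), (6, 4), (9, 7), (12,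
    10), (15, 13), (18, 16)])])
    (is :=
    [0, 1, 2, 7, 14, 15, 16, 19, 20, 10, 4, 12, 9, 6, 18, 11, 5, 17, 3, 13, 2, 16, 10, 4, 18, 8,
    1, 3])
    (l := [82432, 1007252]) (ws :=
    [(673538, 144467319593179672), (58169, 10376293953985073154), (35360, 40533015122214920), (0,
    1)])
    (by decide +kernel) (by decide +kernel) ?_
  simp only [List.forall_mem_cons, List.not_mem_nil, false_imp_iff, implies_true, and_true]
  exact ⟨classified_of_reflection (w := 7505328529586831360)
    (by simp [representatives, fun6_eq_ofTable]) (by decide +kernel),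
    classified_of_lowerTest (by decide +kernel)⟩

theorem onCoset_classified_9223512776490647553 : OnCoset 3 Classified (ofTable 9223512776490647553) := by
  refine onCoset_classified (gens :=
    [([(0, 1)], [(20, 15), (4, 10), (5, 11), (6, 12), (7, 13), (8, 14), (9, 15)]), ([(0, 2)],
    [(20, 18), (1, 10), (2, 11), (3, 12), (7, 16), (8, 17), (9, 18)]), ([(0, 3)], [(20, 19), (0,
    10), (2, 13), (3, 14), (5, 16), (6, 17), (9, 19)]), ([(0, 4)], [(0, 11), (1, 13), (3, 15), (4,
    16), (6, 18), (8, 19)]), ([(0, 5)], [(0, 12), (1, 14), (2, 15), (4, 17), (5, 18), (7, 19)]),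
    ([(1, 0)], [(20, 9), (10, 4), (11, 5), (12, 6), (13, 7), (14, 8), (15, 9)]), ([(1, 2)], [(20,
    18), (1, 4), (2, 5), (3, 6), (13, 16), (14, 17), (15, 18)]), ([(1, 3)], [(20, 19), (0, 4), (2,
    7), (3, 8), (11, 16), (12, 17), (15, 19)]), ([(2, 0)], [(20, 9), (10, 1), (11, 2), (12, 3),
    (16, 7), (17, 8), (18, 9)]), ([(2, 1)], [(20, 15), (4, 1), (5, 2), (6, 3), (16, 13), (17, 14),
    (18, 15)]), ([(2, 3)], [(20, 19), (0, 1), (5, 7), (6, 8), (11, 13), (12, 14), (18, 19)]),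
    ([(2, 4)], [(0, 2), (4, 7), (6, 9), (10, 13), (12, 15), (17, 19)]), ([(3, 0)], [(20, 9), (10,
    0), (13, 2), (14, 3), (16, 5), (17, 6), (19, 9)]), ([(3, 1)], [(20, 15), (4, 0), (7, 2), (8,
    3), (16, 11), (17, 12), (19, 15)]), ([(3, 2)], [(20, 18), (1, 0), (7, 5), (8, 6), (13, 11),
    (14, 12), (19, 18)]), ([(3, 4)], [(1, 2), (4, 5), (8, 9), (10, 11), (14, 15), (17, 18)]),
    ([(4, 5)], [(2, 3), (5, 6), (7, 8), (11, 12), (13, 14), (16, 17)]), ([(5, 4)], [(3, 2), (6,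
    5), (8, 7), (12, 11), (14, 13), (17, 16)])])
    (is :=
    [9, 14, 10, 3, 15, 0, 1, 5, 8, 16, 17, 7, 13, 6, 11, 0, 4, 12, 2, 16, 6, 17, 5, 9, 7, 1])
    (l := [889600, 838592, 787648]) (ws :=
    [(89759, 1155806623156061216), (941248, 23103075812393506), (828198, 2386926564039230017),
    (392636, 4648031766897624072), (158815, 13943848133916172292), (108635, 2305873795682011200),
    (819984, 3472556792024793088), (766848, 38598366447837314), (463304, 576531263859984488),
    (481104, 171207447183229953), (740332, 364827888670212161), (131336, 595671432487518210),
    (577864, 9017369739397441), (819364, 562961764696064), (512, 4611756388245323777), (819712,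
    281479271743488)])
    (by decide +kernel) (by decide +kernel) ?_
  simp only [List.forall_mem_cons, List.not_mem_nil, false_imp_iff, implies_true, and_true]
  exact ⟨classified_of_reflection (w := 2109945805996589056)
    (by simp [representatives, fun7_eq_ofTable]) (by decide +kernel),
    classified_of_reflection (w := 14312697726882578432)
    (by simp [representatives, fun8_eq_ofTable]) (by decide +kernel),
    classified_of_reflection (w := 4150665397693059072)
    (by simp [representatives, fun10_eq_ofTable]) (by decide +kernel)⟩

theorem onCoset_classified_612630838848258049 : OnCoset 3 Classified (ofTable 612630838848258049) := by
  refine onCoset_classified (gens :=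
    [([(0, 1)], [(20, 12), (20, 13), (4, 10), (5, 11), (6, 12), (7, 13), (8, 14), (9, 15)]), ([(0,
    2)], [(20, 16), (1, 10), (2, 11), (3, 12), (7, 16), (8, 17), (9, 18)]), ([(0, 3)], [(20, 17),
    (0, 10), (2, 13), (3, 14), (5, 16), (6, 17), (9, 19)]), ([(0, 5)], [(20, 19), (0, 12), (1,
    14), (2, 15), (4, 17), (5, 18), (7, 19)]), ([(1, 0)], [(20, 6), (20, 7), (10, 4), (11, 5),
    (12, 6), (13, 7), (14, 8), (15, 9)]), ([(1, 2)], [(20, 16), (1, 4), (2, 5), (3, 6), (13, 16),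
    (14, 17), (15, 18)]), ([(1, 3)], [(20, 17), (0, 4), (2, 7), (3, 8), (11, 16), (12, 17), (15,
    19)]), ([(1, 5)], [(20, 19), (0, 6), (1, 8), (2, 9), (10, 17), (11, 18), (13, 19)]), ([(2,
    5)], [(20, 19), (0, 3), (4, 8), (5, 9), (10, 14), (11, 15), (16, 19)]), ([(3, 4)], [(20, 18),
    (1, 2), (4, 5), (8, 9), (10, 11), (14, 15), (17, 18)]), ([(4, 3)], [(20, 17), (2, 1), (5, 4),
    (9, 8), (11, 10), (15, 14), (18, 17)]), ([(5, 2)], [(20, 16), (3, 0), (8, 4), (9, 5), (14,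
    10), (15, 11), (19, 16)]), ([(2, 3), (4, 5)], [(0, 1), (5, 7), (6, 8), (11, 13), (12, 14),
    (18, 19), (2, 3), (5, 6), (7, 8), (11, 12), (13, 14), (16, 17)]), ([(2, 4), (3, 5)], [(0, 2),
    (4, 7), (6, 9), (10, 13), (12, 15), (17, 19), (1, 3), (4, 6), (7, 9), (10, 12), (13, 15), (16,
    18)]), ([(3, 2), (5, 4)], [(1, 0), (7, 5), (8, 6), (13, 11), (14, 12), (19, 18), (3, 2), (6,
    5), (8, 7), (12, 11), (14, 13), (17, 16)]), ([(4, 2), (5, 3)], [(2, 0), (7, 4), (9, 6), (13,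
    10), (15, 12), (19, 17), (3, 1), (6, 4), (9, 7), (12, 10), (15, 13), (18, 16)])])
    (is :=
    [12, 13, 14, 15, 8, 0, 11, 4, 6, 9, 3, 10, 2, 14, 7, 5, 0, 12, 9, 8, 15, 13, 1])
    (l := [1010368, 1010176]) (ws :=
    [(527132, 2378065736229748866), (130376, 2308314716228837378), (531578, 16212958658675376152),
    (322238, 1189039662715798018), (22498, 148763374086586417), (941839, 6197129166098276352),
    (995824, 2383004536766730240), (816811, 435196600030069265), (483516, 13979459391259150988),
    (12821, 148654041080791233), (382265, 184999435422434312), (799118, 20619602166305), (409699,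
    157916808878310401), (376266, 146384597462238212), (639488, 36354394337910824), (196800,
    306249189892030465), (345664, 577617799313899784), (604288, 9800019706722189568), (883674,
    4767060804723802401), (46224, 1154049363020122176), (487890, 9259418431466377473), (866529,
    7350024125466873856), (415071, 1807649896916869248), (119520, 1154896236418957364), (523760,
    87829126276223008), (897188, 11529357984224329728), (307296, 1594282102193394689), (537824,
    4899916759677079688), (272384, 9952957512951040001), (579408, 9840375081544454168), (474304,
    95793919777832976), (653808, 11332134010650657), (85200, 2306565423124983810), (820944,
    6917568610600747559), (572128, 1227512412115046529), (93184, 9268973904341237761), (995968,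
    844566680961313), (413888, 4629718013417902144), (667840, 4785074872586257), (864448,
    18691714519040)])
    (by decide +kernel) (by decide +kernel) ?_
  simp only [List.forall_mem_cons, List.not_mem_nil, false_imp_iff, implies_true, and_true]
  exact ⟨classified_of_reflection (w := 1666355502744911872)
    (by simp [representatives, fun9_eq_ofTable]) (by decide +kernel),
    classified_of_reflection (w := 1445889953410105344)
    (by simp [representatives, fun11_eq_ofTable]) (by decide +kernel)⟩

theorem onCoset_classified_16755818338713600001 : OnCoset 3 Classified (ofTable 16755818338713600001) := by
  refine onCoset_classified (gens :=
    [([(0, 5)], [(20, 15), (20, 17), (0, 12), (1, 14), (2, 15), (4, 17), (5, 18), (7, 19)]), ([(1,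
    4)], [(20, 9), (20, 16), (0, 5), (1, 7), (3, 9), (10, 16), (12, 18), (14, 19)]), ([(2, 3)],
    [(20, 8), (20, 13), (0, 1), (5, 7), (6, 8), (11, 13), (12, 14), (18, 19)]), ([(3, 2)], [(20,
    6), (20, 11), (1, 0), (7, 5), (8, 6), (13, 11), (14, 12), (19, 18)]), ([(4, 1)], [(20, 3),
    (20, 10), (5, 0), (7, 1), (9, 3), (16, 10), (18, 12), (19, 14)]), ([(5, 0)], [(20, 2), (20,
    4), (12, 0), (14, 1), (15, 2), (17, 4), (18, 5), (19, 7)]), ([(0, 1), (4, 5)], [(20, 10), (20,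
    17), (4, 10), (5, 11), (6, 12), (7, 13), (8, 14), (9, 15), (2, 3), (5, 6), (7, 8), (11, 12),
    (13, 14), (16, 17)]), ([(0, 2), (3, 5)], [(20, 11), (20, 15), (1, 10), (2, 11), (3, 12), (7,
    16), (8, 17), (9, 18), (1, 3), (4, 6), (7, 9), (10, 12), (13, 15), (16, 18)]), ([(0, 3), (2,
    5)], [(20, 13), (20, 15), (0, 10), (2, 13), (3, 14), (5, 16), (6, 17), (9, 19), (0, 3), (4,
    8), (5, 9), (10, 14), (11, 15), (16, 19)]), ([(0, 4), (1, 5)], [(20, 16), (20, 17), (0, 11),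
    (1, 13), (3, 15), (4, 16), (6, 18), (8, 19), (0, 6), (1, 8), (2, 9), (10, 17), (11, 18), (13,
    19)]), ([(1, 0), (5, 4)], [(20, 4), (20, 16), (10, 4), (11, 5), (12, 6), (13, 7), (14, 8),
    (15, 9), (3, 2), (6, 5), (8, 7), (12, 11), (14, 13), (17, 16)]), ([(1, 2), (3, 4)], [(20, 6),
    (20, 9), (1, 4), (2, 5), (3, 6), (13, 16), (14, 17), (15, 18), (1, 2), (4, 5), (8, 9), (10,
    11), (14, 15), (17, 18)]), ([(1, 3), (2, 4)], [(20, 8), (20, 9), (0, 4), (2, 7), (3, 8), (11,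
    16), (12, 17), (15, 19), (0, 2), (4, 7), (6, 9), (10, 13), (12, 15), (17, 19)]), ([(2, 0), (5,
    3)], [(20, 2), (20, 13), (10, 1), (11, 2), (12, 3), (16, 7), (17, 8), (18, 9), (3, 1), (6, 4),
    (9, 7), (12, 10), (15, 13), (18, 16)]), ([(2, 1), (4, 3)], [(20, 3), (20, 8), (4, 1), (5, 2),
    (6, 3), (16, 13), (17, 14), (18, 15), (2, 1), (5, 4), (9, 8), (11, 10), (15, 14), (18, 17)]),
    ([(3, 0), (5, 2)], [(20, 2), (20, 11), (10, 0), (13, 2), (14, 3), (16, 5), (17, 6), (19, 9),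
    (3, 0), (8, 4), (9, 5), (14, 10), (15, 11), (19, 16)]), ([(3, 1), (4, 2)], [(20, 3), (20, 6),
    (4, 0), (7, 2), (8, 3), (16, 11), (17, 12), (19, 15), (2, 0), (7, 4), (9, 6), (13, 10), (15,
    12), (19, 17)]), ([(4, 0), (5, 1)], [(20, 4), (20, 10), (11, 0), (13, 1), (15, 3), (16, 4),
    (18, 6), (19, 8), (6, 0), (8, 1), (9, 2), (17, 10), (18, 11), (19, 13)])])
    (is :=
    [3, 6, 7, 10, 13, 14, 16, 12, 0, 5, 11, 2, 15, 8, 9, 17, 4, 1, 7, 16, 12, 2, 5])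
    (l := [306768]) (ws :=
    [(1031987, 4612853736333706258), (783683, 6341358580800978977), (335099, 451507852885101600),
    (762845, 144680344216670274), (203008, 2902713481042591745), (655325, 5336769991385579656),
    (247988, 54053129938814092), (489190, 16429210650599096352), (735181, 5836950998820093992),
    (174504, 13510799438424465), (209089, 432521487430812032), (239824, 864691128455546947),
    (90952, 45179074519239176), (1001041, 9224082356263110680), (363440, 4899916962634678785),
    (331660, 437451696228073504), (1006868, 108090857898381312)])
    (by decide +kernel) (by decide +kernel) ?_
  simp only [List.forall_mem_cons, List.not_mem_nil, false_imp_iff, implies_true, and_true]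
  exact classified_of_reflection (w := 2326197756613920768)
    (by simp [representatives, fun12_eq_ofTable]) (by decide +kernel)

theorem onCoset_onCoset_classified :
    OnCoset 4 (OnCoset 3 Classified) (ofTable 1) := by
  refine affineInvariant_classified.onCoset.onCoset_of_closureTest (n := 15) rfl (gens :=
    [([(0, 2)], [(0, 5), (2, 9), (3, 10), (4, 11)]), ([(0, 3)], [(0, 6), (1, 9), (3, 12), (4,
    13)]), ([(0, 4)], [(0, 7), (1, 10), (2, 12), (4, 14)]), ([(1, 0)], [(5, 1), (6, 2), (7, 3),
    (8, 4)]), ([(1, 2)], [(0, 1), (6, 9), (7, 10), (8, 11)]), ([(1, 3)], [(0, 2), (5, 9), (7, 12),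
    (8, 13)]), ([(1, 5)], [(0, 4), (5, 11), (6, 13), (7, 14)]), ([(2, 0)], [(5, 0), (9, 2), (10,
    3), (11, 4)]), ([(2, 1)], [(1, 0), (9, 6), (10, 7), (11, 8)]), ([(2, 4)], [(1, 3), (5, 7), (9,
    12), (11, 14)]), ([(3, 0)], [(6, 0), (9, 1), (12, 3), (13, 4)]), ([(3, 1)], [(2, 0), (9, 5),
    (12, 7), (13, 8)]), ([(3, 4)], [(2, 3), (6, 7), (9, 10), (13, 14)]), ([(3, 5)], [(2, 4), (6,
    8), (9, 11), (12, 14)]), ([(4, 0)], [(7, 0), (10, 1), (12, 2), (14, 4)]), ([(4, 2)], [(3, 1),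
    (7, 5), (12, 9), (14, 11)]), ([(4, 5)], [(3, 4), (7, 8), (10, 11), (12, 13)]), ([(5, 1)], [(4,
    0), (11, 5), (13, 6), (14, 7)]), ([(5, 4)], [(4, 3), (8, 7), (11, 10), (13, 12)])])
    (is :=
    [14, 15, 18, 8, 9, 16, 7, 10, 0, 1, 12, 2, 13, 14, 4, 17, 11, 6, 7, 5, 2, 11, 3])
    (l := [0, 16384, 6144, 656]) (by decide +kernel) ?_
  simp only [List.forall_mem_cons, List.not_mem_nil, false_imp_iff, implies_true, and_true,
    ← ofTable_xor]
  have h0 : 1 ^^^ linTable (monoAt 4) 0 15 = 1 := by decide +kernel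
  have h1 : 1 ^^^ linTable (monoAt 4) 16384 15 = 9223512776490647553 := by decide +kernel
  have h2 : 1 ^^^ linTable (monoAt 4) 6144 15 = 612630838848258049 := by decide +kernel
  have h3 : 1 ^^^ linTable (monoAt 4) 656 15 = 16755818338713600001 := by decide +kernel
  rw [h0, h1, h2, h3]
  exact ⟨onCoset_classified_1, onCoset_classified_9223512776490647553, onCoset_classified_612630838848258049, onCoset_classified_16755818338713600001⟩

theorem classified_ofTable_one_add {g : BF 6} (hg : g ∈ RM 5 6) :
    Classified (ofTable 1 + g) := by
  have h : OnCoset 5 (OnCoset 4 (OnCoset 3 Classified)) (ofTable 1) := by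
    refine affineInvariant_classified.onCoset.onCoset.onCoset_of_closureTest (n := 6) rfl (gens :=
      [([(6, 0)], [(6, 0)]), ([(6, 1)], [(6, 1)]), ([(6, 2)], [(6, 2)]), ([(6, 3)], [(6, 3)]),
      ([(6, 4)], [(6, 4)]), ([(6, 5)], [(6, 5)])])
      (is := [0, 1, 2, 3, 4, 5]) (l := [0]) (by decide +kernel) ?_
    simp only [List.forall_mem_cons, List.not_mem_nil, false_imp_iff, implies_true, and_true,
      ofTable_linTable, lin_zero, add_zero]
    exact onCoset_onCoset_classified
  simpa only [add_zero] using h g hg 0 (zero_mem_RM 4 6) 0 (zero_mem_RM 3 6)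

theorem nl_ne_of_odd {f : BF 6} (hf : f ∈ RM 5 6) {k : ℕ} (hk : Odd k) : nl 2 f ≠ k := by
  intro h
  obtain ⟨g, ⟨p, hp, hg⟩, e⟩ := exists_nl_eq_hd 2 f
  obtain ⟨p', hp', hfg⟩ := add_mem_RM hf ⟨p, hp.trans (by norm_num), hg⟩
  have hsum := MvPolynomial.sum_eval_eq_zero p' (by rw [ZMod.card, Fintype.card_fin]; omega)
  have hcard : (hd f g : ZMod 2) = ∑ x, (f + g) x := by
    rw [hd, Finset.card_filter, Nat.cast_sum]
    refine Finset.sum_congr rfl fun x _ => ?_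
    rw [Pi.add_apply]
    generalize f x = a, g x = b
    revert a b
    decide
  rw [← e, h, ZMod.natCast_eq_one_iff_odd.2 hk] at hcard
  simp only [hfg, hsum] at hcard
  exact one_ne_zero hcard

theorem classified (f : BF 6) : Classified f := by
  obtain ⟨c, hc, g, hg, rfl⟩ := exists_eq_lin_monoAt_add (r := 5) (mem_RM_of_card f)
  have hc' : c = 0 ∨ c = 1 := by
    have : c < 2 ^ 1 := hc
    omega
  rcases hc' with rfl | rfl
  · rw [lin_zero, zero_add]
    exact fun h => absurd h (nl_ne_of_odd hg (by decide))
  · have h : ofTable (monoAt 6 0 ^^^ 1) ∈ RM 5 6 := ofTable_mem_RM (by decide +kernel)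
    rw [show 1 = 2 ^ 0 by rfl, lin_two_pow _ (by decide)]
    have := classified_ofTable_one_add (add_mem_RM h hg)
    rwa [ofTable_xor, add_comm (ofTable (monoAt 6 0)), add_assoc, ← add_assoc (ofTable 1),
      vec_add_self, zero_add] at this

/-- `nl_2(f) = 15` iff `f` is affine equivalent modulo `RM(2,6)` to one of
`fun6, ..., fun12`. -/
theorem stmt6 (f : BF 6) :
    nl 2 f = 15 ↔
      (AffEquivMod 2 6 f fun6 ∨ AffEquivMod 2 6 f fun7 ∨ AffEquivMod 2 6 f fun8 ∨
        AffEquivMod 2 6 f fun9 ∨ AffEquivMod 2 6 f fun10 ∨ AffEquivMod 2 6 f fun11 ∨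
        AffEquivMod 2 6 f fun12) := by
  refine ⟨fun h => by simpa [representatives] using classified f h, fun h => ?_⟩
  have of_rep {h : BF 6} (hh : nl 2 h = 15) (e : AffEquivMod 2 6 f h) : nl 2 f = 15 := by
    obtain ⟨t, ht, hf⟩ := affEquivMod_iff.1 e
    exact (affineInvariant_nl_eq 2 15).transfer ht (by rwa [add_comm] at hf) hh
  rcases h with h | h | h | h | h | h | h
  · exact of_rep nl_fun6 h
  · exact of_rep nl_fun7 h
  · exact of_rep nl_fun8 h
  · exact of_rep nl_fun9 h
  · exact of_rep nl_fun10 h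
  · exact of_rep nl_fun11 h
  · exact of_rep nl_fun12 h
end

section
/- The following counting values hold: NFh_{fun_1}(16)=448, NFh_{fun_1}(26)=0, NFh_{fun_1}(28)=64; NFh_{fun_2}(16)=384, NFh_{fun_2}(26)=1024, NFh_{fun_2}(28)=0; NFh_{fun_3}(16)=64 and NFh_{fun_3}(i)=0 for all i ≥ 26; NFh_{fun_4}(16)=224, NFh_{fun_4}(26)=512, NFh_{fun_4}(28)=0; NFh_{fun_5}(16)=272 and NFh_{fun_5}(i)=0 for all i ≥ 26; NFh_{fun_6}(15)=112, NFh_{fun_6}(25)=0, NFh_{fun_6}(27)=64; NFh_{fun_7}(15)=96, NFh_{fun_7}(25)=1024, NFh_{fun_7}(27)=0; NFh_{fun_8}(15)=16 and NFh_{fun_8}(i)=0 for all i ≥ 25; NFh_{fun_9}(15)=72, NFh_{fun_9}(25)=512, NFh_{fun_9}(27)=0; NFh_{fun_10}(15)=72, NFh_{fun_10}(25)=256, NFh_{fun_10}(27)=0; NFh_{fun_11}(15)=40, NFh_{fun_11}(25)=544, NFh_{fun_11}(27)=0; NFh_{fun_12}(15)=66, NFh_{fun_12}(25)=414, NFh_{fun_12}(27)=0.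 -/
open scoped BigOperators

/-- The natural number whose `2 ^ m` lowest bits are set. -/
def laneMask (m : ℕ) : ℕ := 2 ^ 2 ^ m - 1

/-- The natural number whose `j`-th bit is the `k`-th bit of `j`, for `j < 2 ^ m`. -/
def coordBits : ℕ → ℕ → ℕ
  | 0, _ => 0
  | m + 1, k =>
    if k = m then laneMask m <<< 2 ^ m else coordBits m k ||| coordBits m k <<< 2 ^ m

/-- Bit-sliced ripple-carry addition of little-endian numbers, truncated to the common length. -/
def addCarry : ℕ → List ℕ → List ℕ → List ℕ
  | c, x :: xs, y :: ys =>
    ((x ^^^ y) ^^^ c) :: addCarry ((x &&& y) ^^^ (c &&& (x ^^^ y))) xs ys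
  | _, _, _ => []

/-- Bit-sliced addition. -/
def laneAdd (xs ys : List ℕ) : List ℕ := addCarry 0 xs ys

/-- Bit-sliced subtraction in two's complement, on `2 ^ m` lanes. -/
def laneSub (m : ℕ) (xs ys : List ℕ) : List ℕ :=
  addCarry (laneMask m) xs (ys.map (laneMask m ^^^ ·))

/-- The bit-sliced constant `k`, with `w` bits on `2 ^ m` lanes. -/
def laneConst (m : ℕ) : ℕ → ℕ → List ℕ
  | 0, _ => []
  | w + 1, k => (if k % 2 = 1 then laneMask m else 0) :: laneConst m w (k / 2)

/-- Binary trees of depth `n`, viewed as tables of values indexed by `F_2^n`. -/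
def CubeTable (α : Type) : ℕ → Type
  | 0 => α
  | n + 1 => CubeTable α n × CubeTable α n

/-- The table of values of a function on `F_2^n`. -/
def CubeTable.ofFn {α : Type} : (n : ℕ) → ((Fin n → ZMod 2) → α) → CubeTable α n
  | 0, F => F ![]
  | n + 1, F => (ofFn n fun x => F (Fin.cons 0 x), ofFn n fun x => F (Fin.cons 1 x))

/-- The pointwise combination of two tables. -/
def CubeTable.zipWith {α : Type} (op : α → α → α) :
    (n : ℕ) → CubeTable α n → CubeTable α n → CubeTable α n
  | 0, s, t => op s t
  | n + 1, s, t => (zipWith op n s.1 t.1, zipWith op n s.2 t.2)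

/-- The lanes in which all Walsh coefficients of a table pass the test `ok`. -/
def walshTest (m : ℕ) (ok : List ℕ → ℕ) : (n : ℕ) → CubeTable (List ℕ) n → ℕ
  | 0, t => ok t
  | n + 1, t =>
    walshTest m ok n (CubeTable.zipWith laneAdd n t.1 t.2) &&&
      walshTest m ok n (CubeTable.zipWith (laneSub m) n t.1 t.2)

/-- The lanes in which a little-endian number exceeds the constant `c`, where `acc` is the answer
in case of equality. -/
def gtTest : ℕ → ℕ → List ℕ → ℕ
  | acc, _, [] => acc
  | acc, c, x :: xs => gtTest (if c % 2 = 0 then x ||| acc else x &&& acc) (c / 2) xs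

/-- The lanes in which a signed 8-bit number `w` satisfies `|w| ≤ 64 - 2 * r`. -/
def absLeTest (m r : ℕ) (w : List ℕ) : ℕ :=
  gtTest 0 (2 * r - 1) (laneAdd (laneConst m 8 64) w) &&&
    (laneMask m ^^^ gtTest 0 (128 - 2 * r) (laneAdd (laneConst m 8 64) w))

/-- The number of set bits among the `2 ^ n` lowest bits. -/
def popCount : ℕ → ℕ → ℕ
  | 0, X => X % 2
  | n + 1, X => if X = 0 then 0 else popCount n (X % 2 ^ 2 ^ n) + popCount n (X >>> 2 ^ n)

/-- The pairs `i < j` of indices of six variables. -/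
def varPairs : List (Fin 6 × Fin 6) :=
  [(0, 1), (0, 2), (0, 3), (0, 4), (0, 5), (1, 2), (1, 3), (1, 4), (1, 5), (2, 3), (2, 4),
    (2, 5), (3, 4), (3, 5), (4, 5)]

/-- Evaluation in all lanes at `x` of `f` plus a quadratic form: starting from index `k`, the
coefficient of the `k`-th pair in lane `j` is the `k`-th bit of `j`. -/
def laneEval (m : ℕ) (f : BF 6) (x : Fin 6 → ZMod 2) : ℕ → List (Fin 6 × Fin 6) → ℕ
  | _, [] => if f x = 0 then 0 else laneMask m
  | k, p :: ps =>
    (if x p.1 * x p.2 = 0 then 0 else coordBits m k) ^^^ laneEval m f x (k + 1) ps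

/-- The 8-bit two's complement number `1 - 2 b` for a bit `b`. -/
def signBits (m b : ℕ) : List ℕ := [laneMask m, b, b, b, b, b, b, b]

/-- The lanes `j` for which `f` plus the `j`-th quadratic form has nonlinearity at least `r`. -/
def nlTest (f : BF 6) (r : ℕ) : ℕ :=
  walshTest 15 (absLeTest 15 r) 6
    (CubeTable.ofFn 6 fun x => signBits 15 (laneEval 15 f x 0 varPairs))

theorem testBit_laneMask (m j : ℕ) : (laneMask m).testBit j = decide (j < 2 ^ m) := by
  simp [laneMask, Nat.testBit_two_pow_sub_one]

theorem coordBits_lt (m k : ℕ) : coordBits m k < 2 ^ 2 ^ m := by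
  induction m with
  | zero => simp [coordBits]
  | succ m ih =>
    have hpow : (2 : ℕ) ^ 2 ^ (m + 1) = 2 ^ 2 ^ m * 2 ^ 2 ^ m := by
      rw [← pow_add]; congr 1; ring
    have hpos : 0 < 2 ^ 2 ^ m := by positivity
    have hshift {y : ℕ} (hy : y < 2 ^ 2 ^ m) : y <<< 2 ^ m < 2 ^ 2 ^ (m + 1) := by
      rw [Nat.shiftLeft_eq, hpow]
      exact Nat.mul_lt_mul_of_pos_right hy hpos
    rw [coordBits]
    split_ifs
    · exact hshift (by simp only [laneMask]; omega)
    · refine Nat.or_lt_two_pow (ih.trans_le ?_) (hshift ih)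
      exact Nat.pow_le_pow_right two_pos (Nat.pow_le_pow_right two_pos m.le_succ)

theorem testBit_coordBits {m k j : ℕ} (hk : k < m) (hj : j < 2 ^ m) :
    (coordBits m k).testBit j = j.testBit k := by
  induction m generalizing j with
  | zero => omega
  | succ m ih =>
    rw [pow_succ] at hj
    rw [coordBits]
    split_ifs with h
    · subst h
      rw [Nat.testBit_shiftLeft, testBit_laneMask]
      by_cases hjm : j < 2 ^ k
      · simp [Nat.testBit_lt_two_pow hjm, hjm]
      · obtain ⟨i, rfl⟩ := Nat.exists_eq_add_of_le (not_lt.mp hjm)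
        have hi : i < 2 ^ k := by omega
        simp [Nat.testBit_two_pow_add_eq, Nat.testBit_lt_two_pow hi, hi]
    · have hkm : k < m := by omega
      rw [Nat.testBit_or, Nat.testBit_shiftLeft]
      by_cases hjm : j < 2 ^ m
      · simp [ih hkm hjm, not_le.mpr hjm]
      · obtain ⟨i, rfl⟩ := Nat.exists_eq_add_of_le (not_lt.mp hjm)
        have hi : i < 2 ^ m := by omega
        have hhigh : (coordBits m k).testBit (2 ^ m + i) = false :=
          Nat.testBit_lt_two_pow ((coordBits_lt m k).trans_le
            (Nat.pow_le_pow_right two_pos (Nat.le_add_right _ _)))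
        simp [hhigh, ih hkm hi, Nat.testBit_two_pow_add_gt hkm]

/-- The number in lane `j` of a bit-sliced little-endian number. -/
def laneVal (j : ℕ) : List ℕ → ℕ
  | [] => 0
  | x :: xs => (x.testBit j).toNat + 2 * laneVal j xs

theorem laneVal_lt (j : ℕ) (xs : List ℕ) : laneVal j xs < 2 ^ xs.length := by
  induction xs with
  | nil => simp [laneVal]
  | cons x xs ih =>
    have := Bool.toNat_le (x.testBit j)
    rw [laneVal, List.length_cons, pow_succ]
    omega

theorem length_addCarry {c : ℕ} {xs ys : List ℕ} (h : xs.length = ys.length) :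
    (addCarry c xs ys).length = xs.length := by
  induction xs generalizing c ys with
  | nil => simp [addCarry]
  | cons x xs ih =>
    cases ys with
    | nil => simp at h
    | cons y ys => simpa [addCarry] using ih (by simpa using h)

theorem exists_laneVal_addCarry (j : ℕ) {c : ℕ} {xs ys : List ℕ} (h : xs.length = ys.length) :
    ∃ k, laneVal j (addCarry c xs ys) + 2 ^ xs.length * k =
      laneVal j xs + laneVal j ys + (c.testBit j).toNat := by
  induction xs generalizing c ys with
  | nil =>
    obtain rfl : ys = [] := List.length_eq_zero_iff.mp h.symm
    exact ⟨(c.testBit j).toNat, by simp [addCarry, laneVal]⟩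
  | cons x xs ih =>
    cases ys with
    | nil => simp at h
    | cons y ys =>
      obtain ⟨k, hk⟩ := ih (c := (x &&& y) ^^^ (c &&& (x ^^^ y))) (by simpa using h)
      refine ⟨k, ?_⟩
      rw [addCarry, laneVal, laneVal, laneVal, List.length_cons, pow_succ, mul_right_comm]
      simp only [Nat.testBit_xor, Nat.testBit_and] at hk ⊢
      generalize x.testBit j = a, y.testBit j = b, c.testBit j = d at hk ⊢
      cases a <;> cases b <;> cases d <;> simp at hk ⊢ <;> omega

theorem laneVal_compl {m j : ℕ} (hj : j < 2 ^ m) (xs : List ℕ) :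
    laneVal j (xs.map (laneMask m ^^^ ·)) + laneVal j xs + 1 = 2 ^ xs.length := by
  induction xs with
  | nil => simp [laneVal]
  | cons x xs ih =>
    simp only [List.map_cons, laneVal, List.length_cons, pow_succ, Nat.testBit_xor,
      testBit_laneMask, hj]
    rcases x.testBit j <;> simp <;> omega

theorem length_laneAdd {xs ys : List ℕ} (h : xs.length = ys.length) :
    (laneAdd xs ys).length = xs.length :=
  length_addCarry h

theorem length_laneSub {m : ℕ} {xs ys : List ℕ} (h : xs.length = ys.length) :
    (laneSub m xs ys).length = xs.length :=
  length_addCarry (by simpa using h)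

/-- The residue modulo `256` of the number in lane `j`. -/
def laneRes (j : ℕ) (xs : List ℕ) : ZMod 256 := laneVal j xs

theorem laneRes_laneAdd (j : ℕ) {xs ys : List ℕ} (hx : xs.length = 8) (hy : ys.length = 8) :
    laneRes j (laneAdd xs ys) = laneRes j xs + laneRes j ys := by
  obtain ⟨k, hk⟩ := exists_laneVal_addCarry j (c := 0) (hx.trans hy.symm)
  have h := congrArg (Nat.cast : ℕ → ZMod 256) hk
  have h256 : (2 : ZMod 256) ^ 8 = 0 := by decide
  simpa only [laneRes, laneAdd, hx, h256, Nat.cast_add, Nat.cast_mul, Nat.cast_pow,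
    Nat.cast_ofNat, zero_mul, add_zero, Nat.zero_testBit, Bool.toNat_false, Nat.cast_zero] using h

theorem laneRes_laneSub {m j : ℕ} (hj : j < 2 ^ m) {xs ys : List ℕ} (hx : xs.length = 8)
    (hy : ys.length = 8) : laneRes j (laneSub m xs ys) = laneRes j xs - laneRes j ys := by
  obtain ⟨k, hk⟩ := exists_laneVal_addCarry j (c := laneMask m)
    (xs := xs) (ys := ys.map (laneMask m ^^^ ·)) (by simp [hx, hy])
  have h := congrArg (Nat.cast : ℕ → ZMod 256) hk
  have hc := congrArg (Nat.cast : ℕ → ZMod 256) (laneVal_compl hj ys)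
  have h256 : (2 : ZMod 256) ^ 8 = 0 := by decide
  simp only [Nat.cast_add, Nat.cast_mul, Nat.cast_pow, Nat.cast_ofNat, Nat.cast_one, hx, hy, h256,
    zero_mul, add_zero, testBit_laneMask, hj, decide_true, Bool.toNat_true] at h hc
  simp only [laneRes, laneSub]
  rw [h]
  linear_combination hc

theorem length_laneConst (m w k : ℕ) : (laneConst m w k).length = w := by
  induction w generalizing k with
  | zero => rfl
  | succ w ih => simp [laneConst, ih]

theorem laneVal_laneConst {m j w k : ℕ} (hj : j < 2 ^ m) (hk : k < 2 ^ w) :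
    laneVal j (laneConst m w k) = k := by
  induction w generalizing k with
  | zero => simp only [laneConst, laneVal]; omega
  | succ w ih =>
    rw [laneConst, laneVal, ih (by omega)]
    split_ifs <;> simp [testBit_laneMask, hj] <;> omega

theorem testBit_gtTest {j acc c : ℕ} {xs : List ℕ} (hc : c < 2 ^ xs.length) :
    (gtTest acc c xs).testBit j = true ↔
      c < laneVal j xs ∨ c = laneVal j xs ∧ acc.testBit j = true := by
  induction xs generalizing acc c with
  | nil =>
    simp only [List.length_nil, pow_zero] at hc
    simp [gtTest, laneVal]; omega
  | cons x xs ih =>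
    rw [List.length_cons, pow_succ] at hc
    rw [gtTest, ih (by omega), laneVal]
    split_ifs with h
    · rw [Nat.testBit_or]
      rcases x.testBit j <;> rcases acc.testBit j <;> simp <;> omega
    · rw [Nat.testBit_and]
      rcases x.testBit j <;> rcases acc.testBit j <;> simp <;> omega

theorem testBit_absLeTest {m j r : ℕ} (hj : j < 2 ^ m) (hr : 1 ≤ r) (hr' : r ≤ 32)
    {xs : List ℕ} (hx : xs.length = 8) :
    (absLeTest m r xs).testBit j = true ↔ |(laneRes j xs).valMinAbs| ≤ 64 - 2 * r := by
  have hlen : (laneAdd (laneConst m 8 64) xs).length = 8 := by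
    rw [length_laneAdd (by rw [length_laneConst, hx]), length_laneConst]
  have hres := laneRes_laneAdd j (length_laneConst m 8 64) hx
  have hw := ZMod.valMinAbs_mem_Ioc (laneRes j xs)
  have hcast := ZMod.coe_valMinAbs (laneRes j xs)
  generalize (laneRes j xs).valMinAbs = w at *
  rw [← hcast, laneRes, laneRes, laneVal_laneConst hj (by norm_num)] at hres
  have hlt := laneVal_lt j (laneAdd (laneConst m 8 64) xs)
  rw [absLeTest, Nat.testBit_and, Nat.testBit_xor, testBit_laneMask, Bool.and_eq_true]
  simp only [hj, decide_true, Bool.true_xor, Bool.not_eq_true', ← Bool.not_eq_true]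
  rw [testBit_gtTest (by rw [hlen]; omega), testBit_gtTest (by rw [hlen]; omega)]
  rw [hlen] at hlt
  simp only [Nat.zero_testBit, Bool.false_eq_true, and_false, or_false]
  generalize laneVal j (laneAdd (laneConst m 8 64) xs) = u at *
  have hmod : ((u : ℤ) : ZMod 256) = ((64 + w : ℤ) : ZMod 256) := by
    push_cast at hres ⊢; exact hres
  rw [ZMod.intCast_eq_intCast_iff, Int.ModEq] at hmod
  rw [abs_le]
  obtain ⟨hw₁, hw₂⟩ := hw
  push_cast at hw₁ hw₂ hmod
  omega

theorem CubeTable.zipWith_ofFn {α : Type} (op : α → α → α) {n : ℕ}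
    (F G : (Fin n → ZMod 2) → α) :
    zipWith op n (ofFn n F) (ofFn n G) = ofFn n fun x => op (F x) (G x) := by
  induction n with
  | zero => rfl
  | succ n ih => exact congrArg₂ Prod.mk (ih _ _) (ih _ _)

/-- The sign `(-1)^z`. -/
def zsign (z : ZMod 2) : ℤ := if z = 0 then 1 else -1

theorem zsign_add (y z : ZMod 2) : zsign (y + z) = zsign y * zsign z := by
  revert y z; decide

theorem zsign_sum {ι : Type*} (s : Finset ι) (z : ι → ZMod 2) :
    zsign (∑ i ∈ s, z i) = ∏ i ∈ s, zsign (z i) := by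
  classical
  induction s using Finset.induction_on with
  | empty => simp [zsign]
  | insert i s hi ih => rw [Finset.sum_insert hi, Finset.prod_insert hi, zsign_add, ih]

theorem sum_cons {M : Type*} [AddCommMonoid M] {n : ℕ} (F : (Fin (n + 1) → ZMod 2) → M) :
    ∑ x, F x = ∑ x, (F (Fin.cons 0 x) + F (Fin.cons 1 x)) := by
  rw [← (Fin.consEquiv fun _ => ZMod 2).sum_comp, Fintype.sum_prod_type, Finset.sum_comm]
  refine Finset.sum_congr rfl fun x _ => ?_
  exact Fin.sum_univ_two (fun i : Fin 2 => F (Fin.cons (i : ZMod 2) x))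

theorem forall_cons {n : ℕ} {p : (Fin (n + 1) → ZMod 2) → Prop} :
    (∀ a, p a) ↔ (∀ a, p (Fin.cons 0 a)) ∧ ∀ a, p (Fin.cons 1 a) := by
  refine ⟨fun h => ⟨fun a => h _, fun a => h _⟩, fun h a => ?_⟩
  rw [← Fin.cons_self_tail a]
  obtain h0 | h1 : a 0 = 0 ∨ a 0 = 1 := by generalize a 0 = z; revert z; decide
  · rw [h0]; exact h.1 _
  · rw [h1]; exact h.2 _

/-- The Walsh-type sum of `F` at `a`. -/
def walshSum {R : Type*} [CommRing R] {n : ℕ} (F : (Fin n → ZMod 2) → R) (a : Fin n → ZMod 2) :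
    R :=
  ∑ x, ((∏ i, zsign (a i * x i) : ℤ) : R) * F x

theorem walshSum_cons_zero {R : Type*} [CommRing R] {n : ℕ} (F : (Fin (n + 1) → ZMod 2) → R)
    (a : Fin n → ZMod 2) :
    walshSum F (Fin.cons 0 a) = walshSum (fun x => F (Fin.cons 0 x) + F (Fin.cons 1 x)) a := by
  rw [walshSum, sum_cons]
  refine Finset.sum_congr rfl fun x _ => ?_
  simp [Fin.prod_univ_succ, zsign, mul_add]

theorem walshSum_cons_one {R : Type*} [CommRing R] {n : ℕ} (F : (Fin (n + 1) → ZMod 2) → R)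
    (a : Fin n → ZMod 2) :
    walshSum F (Fin.cons 1 a) = walshSum (fun x => F (Fin.cons 0 x) - F (Fin.cons 1 x)) a := by
  rw [walshSum, sum_cons]
  refine Finset.sum_congr rfl fun x _ => ?_
  simp [Fin.prod_univ_succ, zsign]
  ring

theorem testBit_walshTest {m j : ℕ} (hj : j < 2 ^ m) {ok : List ℕ → ℕ} {p : ZMod 256 → Prop}
    (hok : ∀ xs, xs.length = 8 → ((ok xs).testBit j = true ↔ p (laneRes j xs))) {n : ℕ}
    (F : (Fin n → ZMod 2) → List ℕ) (hF : ∀ x, (F x).length = 8) :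
    (walshTest m ok n (CubeTable.ofFn n F)).testBit j = true ↔
      ∀ a, p (walshSum (fun x => laneRes j (F x)) a) := by
  induction n with
  | zero =>
    have hsum (a : Fin 0 → ZMod 2) : walshSum (fun x => laneRes j (F x)) a = laneRes j (F ![]) := by
      simp [walshSum, Subsingleton.elim default ![]]
    simp only [hsum, forall_const]
    exact hok _ (hF _)
  | succ n ih =>
    rw [walshTest, Nat.testBit_and, Bool.and_eq_true, forall_cons]
    simp only [CubeTable.ofFn, CubeTable.zipWith_ofFn]
    rw [ih _ fun x => by rw [length_laneAdd] <;> simp [hF],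
      ih _ fun x => by rw [length_laneSub] <;> simp [hF]]
    simp only [walshSum_cons_zero, walshSum_cons_one, laneRes_laneAdd j (hF _) (hF _),
      laneRes_laneSub hj (hF _) (hF _)]

theorem popCount_eq_card (n X : ℕ) :
    popCount n X = ((Finset.range (2 ^ n)).filter fun j => X.testBit j = true).card := by
  induction n generalizing X with
  | zero =>
    rw [popCount, pow_zero, Finset.range_one, Finset.filter_singleton, Nat.testBit_zero]
    split_ifs with h <;> simp at h ⊢ <;> omega
  | succ n ih =>
    rw [popCount]
    split_ifs with h
    · simp [h]
    · simp only [ih, Finset.card_filter]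
      rw [pow_succ, mul_two, Finset.sum_range_add]
      congr 1
      · refine Finset.sum_congr rfl fun j hj => ?_
        simp [Nat.testBit_mod_two_pow, Finset.mem_range.mp hj]
      · simp [Nat.testBit_shiftRight]

/-! ### Affine functions -/

theorem exists_affine_of_mem_RM_one {n : ℕ} {g : BF n} (hg : g ∈ RM 1 n) :
    ∃ (a : Fin n → ZMod 2) (c : ZMod 2), ∀ x, g x = ∑ i, a i * x i + c := by
  obtain ⟨p, hp, hgp⟩ := hg
  have hmon (d : Fin n →₀ ℕ) (hd : d.degree ≤ 1) :
      ∃ (a : Fin n → ZMod 2) (c : ZMod 2), ∀ x : Fin n → ZMod 2,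
        MvPolynomial.eval x (MvPolynomial.monomial d (p.coeff d)) = ∑ i, a i * x i + c := by
    obtain h | h : d.degree = 0 ∨ d.degree = 1 := by omega
    · obtain rfl := (Finsupp.degree_eq_zero_iff d).mp h
      exact ⟨0, p.coeff 0, by simp⟩
    · obtain ⟨i, rfl⟩ := (Finsupp.sum_eq_one_iff d).mp h
      exact ⟨Pi.single i (p.coeff (Finsupp.single i 1)), 0, by
        simp [MvPolynomial.eval_monomial, Pi.single_apply]⟩
  have hdeg (d : Fin n →₀ ℕ) (hd : d ∈ p.support) : d.degree ≤ 1 :=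
    (MvPolynomial.le_totalDegree hd).trans hp
  choose! a c hac using fun d hd => hmon d (hdeg d hd)
  refine ⟨fun i => ∑ d ∈ p.support, a d i, ∑ d ∈ p.support, c d, fun x => ?_⟩
  rw [hgp x]
  conv_lhs => rw [p.as_sum]
  rw [map_sum, Finset.sum_congr rfl fun d hd => hac d hd x, Finset.sum_add_distrib,
    Finset.sum_comm]
  simp only [Finset.sum_mul]

theorem affine_mem_RM_one {n : ℕ} (a : Fin n → ZMod 2) (c : ZMod 2) :
    (fun x => ∑ i, a i * x i + c) ∈ RM 1 n := by
  refine ⟨∑ i, MvPolynomial.C (a i) * MvPolynomial.X i + MvPolynomial.C c, ?_, fun x => by simp⟩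
  refine (MvPolynomial.totalDegree_add _ _).trans (max_le ?_ (by simp))
  refine MvPolynomial.totalDegree_finsetSum_le fun i _ => ?_
  refine (MvPolynomial.totalDegree_mul _ _).trans ?_
  simp

theorem two_mul_hd_affine {n : ℕ} (f : BF n) (a : Fin n → ZMod 2) (c : ZMod 2) :
    2 * (hd f fun x => ∑ i, a i * x i + c : ℤ) =
      2 ^ n - zsign c * walshSum (fun x => zsign (f x)) a := by
  have hbit (u v w : ZMod 2) : 2 * (if u ≠ v + w then 1 else 0 : ℤ) =
      1 - zsign w * (zsign v * zsign u) := by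
    revert u v w; decide
  rw [hd, Finset.card_filter, walshSum]
  push_cast
  rw [Finset.mul_sum, Finset.sum_congr rfl fun x _ => hbit _ _ _, Finset.sum_sub_distrib,
    Finset.mul_sum]
  simp [zsign_sum]

theorem le_nl_one_iff {n : ℕ} (f : BF n) (r : ℕ) :
    r ≤ nl 1 f ↔ ∀ a, |walshSum (fun x => zsign (f x)) a| ≤ 2 ^ n - 2 * r := by
  have hnl : r ≤ nl 1 f ↔
      ∀ (a : Fin n → ZMod 2) (c : ZMod 2), r ≤ hd f fun x => ∑ i, a i * x i + c := by
    constructor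
    · exact fun h a c => h.trans (Nat.sInf_le ⟨_, affine_mem_RM_one a c, rfl⟩)
    · intro h
      obtain ⟨g, hg, hgd⟩ := Nat.sInf_mem
        (s := {d | ∃ g ∈ RM 1 n, d = hd f g}) ⟨_, _, affine_mem_RM_one 0 0, rfl⟩
      obtain ⟨a, c, hac⟩ := exists_affine_of_mem_RM_one hg
      rw [nl, hgd, funext hac]
      exact h a c
  rw [hnl]
  refine forall_congr' fun a => ?_
  have h0 := two_mul_hd_affine f a 0
  have h1 := two_mul_hd_affine f a 1
  rw [show zsign 0 = 1 from rfl] at h0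
  rw [show zsign 1 = -1 from rfl] at h1
  rw [abs_le]
  constructor
  · intro h
    have := h 0
    have := h 1
    constructor <;> linarith
  · intro h c
    obtain rfl | rfl : c = 0 ∨ c = 1 := by revert c; decide
    all_goals zify; linarith [h.1, h.2]

theorem abs_walshSum_zsign_le {n : ℕ} (f : BF n) (a : Fin n → ZMod 2) :
    |walshSum (fun x => zsign (f x)) a| ≤ 2 ^ n := by
  simpa using (le_nl_one_iff f 0).mp (Nat.zero_le _) a

theorem walshSum_intCast {R : Type*} [CommRing R] {n : ℕ} (F : (Fin n → ZMod 2) → ℤ)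
    (a : Fin n → ZMod 2) : walshSum (fun x => (F x : R)) a = (walshSum F a : ℤ) := by
  simp [walshSum]

/-! ### Quadratic forms in six variables -/

/-- The sum of `x p.1 * x p.2` over the pairs `p` selected by the bits of `j`, where the first
pair corresponds to the `k`-th bit. -/
def selectedSum (j : ℕ) (x : Fin 6 → ZMod 2) : ℕ → List (Fin 6 × Fin 6) → ZMod 2
  | _, [] => 0
  | k, p :: ps => (if j.testBit k then x p.1 * x p.2 else 0) + selectedSum j x (k + 1) ps

/-- The homogeneous quadratic function whose coefficients are the bits of `j`. -/
def quadForm (j : ℕ) : BF 6 := fun x => selectedSum j x 0 varPairs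

theorem testBit_laneEval {m j : ℕ} (hj : j < 2 ^ m) (f : BF 6) (x : Fin 6 → ZMod 2) {k : ℕ}
    {ps : List (Fin 6 × Fin 6)} (hk : k + ps.length ≤ m) :
    (laneEval m f x k ps).testBit j = decide (f x + selectedSum j x k ps ≠ 0) := by
  induction ps generalizing k with
  | nil => by_cases h : f x = 0 <;> simp [laneEval, selectedSum, h, testBit_laneMask, hj]
  | cons p ps ih =>
    rw [List.length_cons] at hk
    rw [laneEval, selectedSum, Nat.testBit_xor, ih (by omega)]
    have hbit : (if x p.1 * x p.2 = 0 then 0 else coordBits m k).testBit j =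
        (decide (x p.1 * x p.2 ≠ 0) && j.testBit k) := by
      split_ifs with h <;> simp [h, testBit_coordBits (show k < m by omega) hj]
    have hxor (u v w : ZMod 2) (b : Bool) : ((decide (w ≠ 0) && b) ^^ decide (u + v ≠ 0)) =
        decide (u + ((if b then w else 0) + v) ≠ 0) := by
      revert u v w b; decide
    rw [hbit, hxor]

theorem laneRes_signBits {m j : ℕ} (hj : j < 2 ^ m) {b : ℕ} {z : ZMod 2}
    (hb : b.testBit j = decide (z ≠ 0)) : laneRes j (signBits m b) = zsign z := by
  simp only [laneRes, signBits, laneVal, testBit_laneMask, hj, hb]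
  clear hb
  revert z; decide

theorem testBit_nlTest {j r : ℕ} (hj : j < 2 ^ 15) (hr : 1 ≤ r) (hr' : r ≤ 32) (f : BF 6) :
    (nlTest f r).testBit j = true ↔ r ≤ nl 1 (f + quadForm j) := by
  rw [nlTest, testBit_walshTest hj (p := fun z => |z.valMinAbs| ≤ 64 - 2 * r)
    (fun xs hx => testBit_absLeTest hj hr hr' hx) _ fun _ => rfl, le_nl_one_iff]
  refine forall_congr' fun a => ?_
  have hres (x : Fin 6 → ZMod 2) : laneRes j (signBits 15 (laneEval 15 f x 0 varPairs)) =
      (zsign ((f + quadForm j) x) : ℤ) :=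
    laneRes_signBits hj (testBit_laneEval hj f x (by decide))
  have habs := abs_le.mp (abs_walshSum_zsign_le (f + quadForm j) a)
  simp only [hres, walshSum_intCast]
  rw [(ZMod.valMinAbs_spec _ (walshSum (fun x => zsign ((f + quadForm j) x)) a)).mpr
    ⟨rfl, by constructor <;> push_cast <;> linarith⟩]
  norm_num

theorem quadForm_pair (j : ℕ) {k : ℕ} (hk : k < varPairs.length) :
    quadForm j (fun i => if i = varPairs[k].1 ∨ i = varPairs[k].2 then 1 else 0) =
      if j.testBit k then 1 else 0 := by
  change k < 15 at hk
  interval_cases k <;> simp [quadForm, varPairs, selectedSum]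

theorem quadForm_injOn : Set.InjOn quadForm {j | j < 2 ^ 15} := by
  intro i hi j hj hij
  refine Nat.eq_of_testBit_eq fun k => ?_
  by_cases hk : k < varPairs.length
  · have h := quadForm_pair i hk
    rw [hij, quadForm_pair j hk] at h
    revert h
    cases i.testBit k <;> cases j.testBit k <;> simp
  · have hpow : 2 ^ 15 ≤ 2 ^ k := Nat.pow_le_pow_right two_pos (not_lt.mp hk)
    rw [Nat.testBit_lt_two_pow (lt_of_lt_of_le hi hpow),
      Nat.testBit_lt_two_pow (lt_of_lt_of_le hj hpow)]

theorem selectedSum_eq_sum_map {j k : ℕ} {ps : List (Fin 6 × Fin 6)} {a : Fin 6 → Fin 6 → ZMod 2}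
    (h : ∀ (i : ℕ) (hi : i < ps.length), a ps[i].1 ps[i].2 = if j.testBit (k + i) then 1 else 0)
    (x : Fin 6 → ZMod 2) :
    selectedSum j x k ps = (ps.map fun p => a p.1 p.2 * x p.1 * x p.2).sum := by
  induction ps generalizing k with
  | nil => rfl
  | cons p ps ih =>
    have hp : a p.1 p.2 = if j.testBit k then 1 else 0 := h 0 (Nat.succ_pos _)
    rw [selectedSum, List.map_cons, List.sum_cons, hp, ih fun i hi => ?_]
    · split_ifs <;> simp
    · rw [add_right_comm, add_assoc]
      exact h (i + 1) (Nat.succ_lt_succ hi)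

theorem sum_lt_eq_sum_map_varPairs (b : Fin 6 → Fin 6 → ZMod 2) :
    (∑ p, ∑ q, if p < q then b p q else 0) = (varPairs.map fun p => b p.1 p.2).sum := by
  simp [varPairs, Fin.sum_univ_six]
  ring

theorem homQuad_quadForm (j : ℕ) : HomQuad (quadForm j) := by
  refine ⟨fun p q => if j.testBit (varPairs.idxOf (p, q)) then 1 else 0, fun x => ?_⟩
  rw [sum_lt_eq_sum_map_varPairs]
  refine selectedSum_eq_sum_map
    (a := fun p q => if j.testBit (varPairs.idxOf (p, q)) then 1 else 0) (fun i hi => ?_) x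
  have hnodup : varPairs.Nodup := by decide
  simp [hnodup.idxOf_getElem i hi]

theorem HomQuad.exists_quadForm {g : BF 6} (hg : HomQuad g) : ∃ j < 2 ^ 15, quadForm j = g := by
  obtain ⟨a, ha⟩ := hg
  refine ⟨Nat.ofBits fun k : Fin varPairs.length => decide (a varPairs[k].1 varPairs[k].2 = 1),
    Nat.ofBits_lt_two_pow _, funext fun x => ?_⟩
  rw [ha x, sum_lt_eq_sum_map_varPairs, quadForm]
  refine selectedSum_eq_sum_map (fun i hi => ?_) x
  have hbit (z : ZMod 2) : z = if decide (z = 1) = true then 1 else 0 := by revert z; decide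
  rw [zero_add, Nat.testBit_ofBits_lt _ _ hi]
  exact hbit _

theorem Fh_eq_image (f : BF 6) (r : ℕ) :
    Fh f r = Set.image quadForm {j | j < 2 ^ 15 ∧ nl 1 (f + quadForm j) = r} := by
  ext g
  constructor
  · rintro ⟨hg, hr⟩
    obtain ⟨j, hj, rfl⟩ := hg.exists_quadForm
    exact ⟨j, ⟨hj, hr⟩, rfl⟩
  · rintro ⟨j, ⟨-, hr⟩, rfl⟩
    exact ⟨homQuad_quadForm j, hr⟩

/-- The number of quadratic forms `g` such that `f + g` has nonlinearity `r`, computed from the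
lanes of `nlTest`. -/
def nlCount (f : BF 6) (r : ℕ) : ℕ := popCount 15 (nlTest f r ^^^ nlTest f (r + 1))

theorem NFh_eq_nlCount (f : BF 6) {r : ℕ} (hr : 1 ≤ r) (hr' : r ≤ 31) :
    NFh f r = nlCount f r := by
  rw [NFh, Fh_eq_image, Set.InjOn.ncard_image (quadForm_injOn.mono fun j hj => hj.1),
    nlCount, popCount_eq_card, ← Set.ncard_coe_finset]
  congr 1
  ext j
  rw [Finset.coe_filter, Set.mem_ofPred_eq, Set.mem_ofPred_eq, Finset.mem_range]
  refine and_congr_right fun hj => ?_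
  have h := testBit_nlTest hj hr (by omega) f
  have h' := testBit_nlTest hj (Nat.le_add_left 1 r) (by omega) f
  rw [Nat.testBit_xor, bne_iff_ne, ne_eq, Bool.eq_iff_iff, h, h']
  omega

theorem NFh_eq_zero_of_nlTest_eq_zero {f : BF 6} {r : ℕ} (hr : 1 ≤ r) (hr' : r ≤ 32)
    (h : nlTest f r = 0) {i : ℕ} (hi : r ≤ i) : NFh f i = 0 := by
  have hempty : Fh f i = ∅ := by
    refine Set.eq_empty_of_forall_notMem ?_
    rw [Fh_eq_image]
    rintro _ ⟨j, ⟨hj, rfl⟩, rfl⟩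
    simpa [h] using (testBit_nlTest hj hr hr' f).mpr hi
  rw [NFh, hempty, Set.ncard_empty]

/-! ### The counting values -/

theorem NFh_fun1 :
    NFh fun1 16 = 448 ∧ NFh fun1 26 = 0 ∧ NFh fun1 28 = 64 := by
  simp only [NFh_eq_nlCount, Nat.reduceLeDiff]
  decide +kernel

theorem NFh_fun2 :
    NFh fun2 16 = 384 ∧ NFh fun2 26 = 1024 ∧ NFh fun2 28 = 0 := by
  simp only [NFh_eq_nlCount, Nat.reduceLeDiff]
  decide +kernel

theorem NFh_fun3 : NFh fun3 16 = 64 ∧ ∀ i, 26 ≤ i → NFh fun3 i = 0 := by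
  have h : nlCount fun3 16 = 64 ∧ nlTest fun3 26 = 0 := by decide +kernel
  exact ⟨by rw [NFh_eq_nlCount _ (by norm_num) (by norm_num), h.1],
    fun i => NFh_eq_zero_of_nlTest_eq_zero (by norm_num) (by norm_num) h.2⟩

theorem NFh_fun4 :
    NFh fun4 16 = 224 ∧ NFh fun4 26 = 512 ∧ NFh fun4 28 = 0 := by
  simp only [NFh_eq_nlCount, Nat.reduceLeDiff]
  decide +kernel

theorem NFh_fun5 : NFh fun5 16 = 272 ∧ ∀ i, 26 ≤ i → NFh fun5 i = 0 := by
  have h : nlCount fun5 16 = 272 ∧ nlTest fun5 26 = 0 := by decide +kernel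
  exact ⟨by rw [NFh_eq_nlCount _ (by norm_num) (by norm_num), h.1],
    fun i => NFh_eq_zero_of_nlTest_eq_zero (by norm_num) (by norm_num) h.2⟩

theorem NFh_fun6 :
    NFh fun6 15 = 112 ∧ NFh fun6 25 = 0 ∧ NFh fun6 27 = 64 := by
  simp only [NFh_eq_nlCount, Nat.reduceLeDiff]
  decide +kernel

theorem NFh_fun7 :
    NFh fun7 15 = 96 ∧ NFh fun7 25 = 1024 ∧ NFh fun7 27 = 0 := by
  simp only [NFh_eq_nlCount, Nat.reduceLeDiff]
  decide +kernel

theorem NFh_fun8 : NFh fun8 15 = 16 ∧ ∀ i, 25 ≤ i → NFh fun8 i = 0 := by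
  have h : nlCount fun8 15 = 16 ∧ nlTest fun8 25 = 0 := by decide +kernel
  exact ⟨by rw [NFh_eq_nlCount _ (by norm_num) (by norm_num), h.1],
    fun i => NFh_eq_zero_of_nlTest_eq_zero (by norm_num) (by norm_num) h.2⟩

theorem NFh_fun9 :
    NFh fun9 15 = 72 ∧ NFh fun9 25 = 512 ∧ NFh fun9 27 = 0 := by
  simp only [NFh_eq_nlCount, Nat.reduceLeDiff]
  decide +kernel

theorem NFh_fun10 :
    NFh fun10 15 = 72 ∧ NFh fun10 25 = 256 ∧ NFh fun10 27 = 0 := by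
  simp only [NFh_eq_nlCount, Nat.reduceLeDiff]
  decide +kernel

theorem NFh_fun11 :
    NFh fun11 15 = 40 ∧ NFh fun11 25 = 544 ∧ NFh fun11 27 = 0 := by
  simp only [NFh_eq_nlCount, Nat.reduceLeDiff]
  decide +kernel

theorem NFh_fun12 :
    NFh fun12 15 = 66 ∧ NFh fun12 25 = 414 ∧ NFh fun12 27 = 0 := by
  simp only [NFh_eq_nlCount, Nat.reduceLeDiff]
  decide +kernel

/-- The counting values of `NFh` on `fun1, ..., fun12`. -/
theorem stmt7 :
    NFh fun1 16 = 448 ∧ NFh fun1 26 = 0 ∧ NFh fun1 28 = 64 ∧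
    NFh fun2 16 = 384 ∧ NFh fun2 26 = 1024 ∧ NFh fun2 28 = 0 ∧
    NFh fun3 16 = 64 ∧ (∀ i, 26 ≤ i → NFh fun3 i = 0) ∧
    NFh fun4 16 = 224 ∧ NFh fun4 26 = 512 ∧ NFh fun4 28 = 0 ∧
    NFh fun5 16 = 272 ∧ (∀ i, 26 ≤ i → NFh fun5 i = 0) ∧
    NFh fun6 15 = 112 ∧ NFh fun6 25 = 0 ∧ NFh fun6 27 = 64 ∧
    NFh fun7 15 = 96 ∧ NFh fun7 25 = 1024 ∧ NFh fun7 27 = 0 ∧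
    NFh fun8 15 = 16 ∧ (∀ i, 25 ≤ i → NFh fun8 i = 0) ∧
    NFh fun9 15 = 72 ∧ NFh fun9 25 = 512 ∧ NFh fun9 27 = 0 ∧
    NFh fun10 15 = 72 ∧ NFh fun10 25 = 256 ∧ NFh fun10 27 = 0 ∧
    NFh fun11 15 = 40 ∧ NFh fun11 25 = 544 ∧ NFh fun11 27 = 0 ∧
    NFh fun12 15 = 66 ∧ NFh fun12 25 = 414 ∧ NFh fun12 27 = 0 := by
  simp only [NFh_fun1, NFh_fun2, NFh_fun3.1, NFh_fun4, NFh_fun5.1, NFh_fun6, NFh_fun7, NFh_fun8.1,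
    NFh_fun9, NFh_fun10, NFh_fun11, NFh_fun12, true_and, and_true]
  exact ⟨NFh_fun3.2, NFh_fun5.2, NFh_fun8.2⟩
end
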